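/- arXiv:2504.14684 — 6 statements merged into one kernel-verified Lean document; each statement's English description precedes it below -/
import Mathlib

section
/- Let Φ be a finite reduced crystallographic root system in a finite-dimensional ℚ-vector space V, with a fixed set of positive roots Φ⁺ and ρ half the sum of the positive roots. Let m be a positive integer and let λ be a dominant integral weight (i.e. ⟨λ, α∨⟩ is a nonnegative integer for every positive root α). Then the number of positive roots α with m dividing ⟨ρ, α∨⟩ is at most the number of positive roots α with m dividing ⟨λ+ρ, α∨⟩. -/
/-- Data of a finite reduced crystallographic root system `Φ` in a `ℚ`-vector space `V`,
together with a choice of positive system `Pos = Φ⁺`. -/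
structure RootSystemData (V : Type*) [AddCommGroup V] [Module ℚ V] where
  /-- the (finite) set of roots -/
  Φ : Finset V
  /-- the coroot `α∨` attached to each root `α` (a linear functional on `V`) -/
  coroot : V → Module.Dual ℚ V
  /-- the set of positive roots -/
  Pos : Finset V
  nonzero : ∀ α ∈ Φ, α ≠ 0
  span_eq_top : Submodule.span ℚ (Φ : Set V) = ⊤
  neg_mem : ∀ α ∈ Φ, -α ∈ Φ
  coroot_self : ∀ α ∈ Φ, coroot α α = 2
  /-- crystallographic: all pairings of roots with coroots are integers -/
  crystallographic : ∀ α ∈ Φ, ∀ β ∈ Φ, ∃ n : ℤ, coroot α β = (n : ℚ)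
  /-- the reflection in a root permutes the set of roots -/
  reflect_mem : ∀ α ∈ Φ, ∀ β ∈ Φ, β - coroot α β • α ∈ Φ
  /-- reduced: the only multiples of a root which are roots are `±` itself -/
  reduced : ∀ α ∈ Φ, ∀ c : ℚ, c • α ∈ Φ → c = 1 ∨ c = -1
  pos_subset : Pos ⊆ Φ
  /-- exactly one of `α`, `-α` is positive -/
  pos_iff : ∀ α ∈ Φ, (α ∈ Pos ↔ -α ∉ Pos)
  /-- positivity is closed under addition of roots -/
  pos_add : ∀ α ∈ Pos, ∀ β ∈ Pos, α + β ∈ Φ → α + β ∈ Pos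

open Finset

namespace RootPairing

variable {ι M N : Type*} [AddCommGroup M] [Module ℚ M] [AddCommGroup N] [Module ℚ N]

/-- A set of indices selecting the positive roots of a root pairing: exactly one root out of each
pair of opposite roots is positive, and a root which is a sum of positive roots is positive. -/
structure IsPositiveSystem (P : RootPairing ι ℚ M N) (pos : Finset ι) : Prop where
  reflectionPerm_self_mem_iff : ∀ i, P.reflectionPerm i i ∈ pos ↔ i ∉ pos
  add_mem : ∀ i ∈ pos, ∀ j ∈ pos, ∀ k, P.root k = P.root i + P.root j → k ∈ pos

lemma root_reflectionPerm_self (P : RootPairing ι ℚ M N) (i : ι) :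
    P.root (P.reflectionPerm i i) = -P.root i := by
  simp

namespace IsPositiveSystem

variable {P : RootPairing ι ℚ M N} {pos : Finset ι}

lemma sum_root_ne_zero [Finite ι] [P.IsCrystallographic] (h : P.IsPositiveSystem pos)
    (s : Multiset ι) (hs : ∀ i ∈ s, i ∈ pos) (h0 : s ≠ 0) : (s.map P.root).sum ≠ 0 := by
  classical
  induction hn : s.card using Nat.strong_induction_on generalizing s with
  | _ n ih =>
  intro hsum
  obtain ⟨i, hi⟩ := Multiset.exists_mem_of_ne_zero h0
  obtain ⟨t, rfl⟩ := Multiset.exists_cons_of_mem hi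
  have hneg : ((t.map fun j ↦ P.pairing j i)).sum = -2 := by
    have := congrArg (P.coroot' i) hsum
    simp only [Multiset.map_cons, Multiset.sum_cons, map_add, map_multiset_sum, Multiset.map_map,
      map_zero] at this
    simp only [Function.comp_def, root_coroot'_eq_pairing, pairing_same] at this
    linarith
  obtain ⟨j, hj, hji⟩ : ∃ j ∈ t, P.pairing j i < 0 := by
    by_contra! hc
    have : 0 ≤ (t.map fun j ↦ P.pairing j i).sum :=
      Multiset.sum_nonneg fun x hx ↦ by
        obtain ⟨j, hj, rfl⟩ := Multiset.mem_map.1 hx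
        exact hc j hj
    linarith
  have hipos := hs i (by simp)
  have hjpos := hs j (by simp [hj])
  have hji' : P.pairingIn ℤ j i < 0 := by
    rw [← P.algebraMap_pairingIn ℤ] at hji
    simpa using hji
  have hne : P.root j ≠ -P.root i := by
    intro he
    rw [P.root_eq_neg_iff] at he
    rw [he, h.reflectionPerm_self_mem_iff] at hjpos
    exact hjpos hipos
  obtain ⟨k, hk⟩ := P.root_add_root_mem_of_pairingIn_neg hji' hne
  obtain ⟨u, rfl⟩ := Multiset.exists_cons_of_mem hj
  refine ih (k ::ₘ u).card (by simp [← hn]) (k ::ₘ u) ?_ (by simp) rfl ?_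
  · intro l hl
    rcases Multiset.mem_cons.1 hl with rfl | hl
    · exact h.add_mem j hjpos i hipos _ hk
    · exact hs l (by simp [hl])
  · simp only [Multiset.map_cons, Multiset.sum_cons] at hsum ⊢
    rw [hk, ← hsum]
    abel

lemma mem_of_root_eq_add_nsmul [Finite ι] [P.IsCrystallographic] (h : P.IsPositiveSystem pos)
    {i j k : ι} (hi : i ∈ pos) (hj : j ∈ pos) (n : ℕ) (hk : P.root k = P.root i + n • P.root j) :
    k ∈ pos := by
  by_contra hc
  rw [← h.reflectionPerm_self_mem_iff] at hc
  refine h.sum_root_ne_zero (P.reflectionPerm k k ::ₘ i ::ₘ Multiset.replicate n j) ?_ (by simp) ?_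
  · intro l hl
    simp only [Multiset.mem_cons] at hl
    rcases hl with rfl | rfl | hl
    · exact hc
    · exact hi
    · rwa [Multiset.eq_of_mem_replicate hl]
  · simp only [Multiset.map_cons, Multiset.sum_cons, root_reflectionPerm_self,
      Multiset.map_replicate, Multiset.sum_replicate]
    rw [hk]
    abel

lemma reflectionPerm_mem_of_pairing_nonpos [Finite ι] [P.IsCrystallographic]
    (h : P.IsPositiveSystem pos) {i j : ι} (hi : i ∈ pos) (hj : j ∈ pos) (hji : P.pairing j i ≤ 0) :
    P.reflectionPerm i j ∈ pos := by
  have hz : P.pairingIn ℤ j i ≤ 0 := by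
    rw [← P.algebraMap_pairingIn ℤ] at hji
    simpa using hji
  obtain ⟨n, hn⟩ := Int.exists_eq_neg_ofNat hz
  refine h.mem_of_root_eq_add_nsmul hj hi n ?_
  have : P.pairing j i = -(n : ℚ) := by simp [← P.algebraMap_pairingIn ℤ, hn]
  rw [root_reflectionPerm, reflection_apply_root, this, ← Nat.cast_smul_eq_nsmul ℚ]
  module

lemma reflectionPerm_self_notMem (h : P.IsPositiveSystem pos) {i : ι} (hi : i ∈ pos) :
    P.reflectionPerm i i ∉ pos := by
  rw [h.reflectionPerm_self_mem_iff]
  exact not_not.2 hi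

lemma sum_filter_reflectionPerm_notMem [DecidableEq ι] (pos : Finset ι) (i : ι) (f : ι → ℚ)
    (hf : ∀ j, f (P.reflectionPerm i j) = -f j) :
    ∑ j ∈ pos with P.reflectionPerm i j ∉ pos, f j = ∑ j ∈ pos, f j := by
  rw [← Finset.sum_filter_add_sum_filter_not pos (fun j ↦ P.reflectionPerm i j ∉ pos) f]
  rw [left_eq_add]
  refine Finset.sum_involution (fun j _ ↦ P.reflectionPerm i j) ?_ ?_ ?_ ?_
  · simp [hf]
  · intro j _ hj he
    have := hf j
    rw [he] at this
    exact hj (by linarith)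
  · simp +contextual
  · simp

lemma sum_pairing_pos [Finite ι] [P.IsCrystallographic] (h : P.IsPositiveSystem pos)
    {i : ι} (hi : i ∈ pos) : 0 < ∑ j ∈ pos, P.pairing j i := by
  classical
  rw [← sum_filter_reflectionPerm_notMem (P := P) pos i (fun j ↦ P.pairing j i)
    (fun j ↦ by simp [← P.pairing_reflectionPerm])]
  refine Finset.sum_pos (fun j hj ↦ ?_) ⟨i, by simp [hi, h.reflectionPerm_self_notMem hi]⟩
  rw [Finset.mem_filter] at hj
  by_contra! hc
  exact hj.2 (h.reflectionPerm_mem_of_pairing_nonpos hi hj.1 hc)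

lemma mem_iff_sum_pairing_pos [Finite ι] [P.IsCrystallographic] (h : P.IsPositiveSystem pos)
    {i : ι} :
    i ∈ pos ↔ 0 < ∑ j ∈ pos, P.pairing j i := by
  refine ⟨h.sum_pairing_pos, fun hi ↦ ?_⟩
  by_contra hc
  have := h.sum_pairing_pos ((h.reflectionPerm_self_mem_iff i).2 hc)
  simp only [pairing_reflectionPerm_self_right, Finset.sum_neg_distrib] at this
  linarith

lemma flip [Finite ι] [P.IsCrystallographic] (h : P.IsPositiveSystem pos) :
    P.flip.IsPositiveSystem pos where
  reflectionPerm_self_mem_iff := h.reflectionPerm_self_mem_iff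
  add_mem i hi j hj k hk := by
    rw [h.mem_iff_sum_pairing_pos] at *
    have (l : ι) : P.pairing l k = P.pairing l i + P.pairing l j :=
      P.flip.pairing_eq_add_of_root_eq_add hk
    simp only [this, Finset.sum_add_distrib]
    positivity

lemma reflectionPerm_mem_of_indecomposable [Finite ι] [P.IsCrystallographic] [P.IsReduced]
    (h : P.IsPositiveSystem pos) {i j : ι} (hi : i ∈ pos)
    (hind : ∀ a ∈ pos, ∀ b ∈ pos, P.root i ≠ P.root a + P.root b) (hj : j ∈ pos) (hji : j ≠ i) :
    P.reflectionPerm i j ∈ pos := by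
  by_contra hc
  set c := P.reflectionPerm (P.reflectionPerm i j) (P.reflectionPerm i j) with hcdef
  have hcpos : c ∈ pos := (h.reflectionPerm_self_mem_iff _).2 hc
  set n := P.pairingIn ℤ j i with hn
  have hn' : P.pairing j i = n := by simp [hn, ← P.algebraMap_pairingIn ℤ]
  have hnpos : 0 < n := by
    by_contra! hle
    exact hc (h.reflectionPerm_mem_of_pairing_nonpos hi hj (by rw [hn']; exact_mod_cast hle))
  have hcroot : P.root c = (n : ℚ) • P.root i - P.root j := by
    rw [hcdef, root_reflectionPerm_self, root_reflectionPerm, reflection_apply_root, hn', neg_sub]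
  have hjneg : P.root j ≠ -P.root i := by
    intro he
    rw [P.root_eq_neg_iff] at he
    exact h.reflectionPerm_self_notMem hi (he ▸ hj)
  have hn3 : n ≤ 3 := by
    have := P.pairingIn_pairingIn_mem_set_of_isCrystal_of_isRed' j i
      (fun he ↦ hji (P.root.injective he)) hjneg
    simp only [← hn, Set.mem_insert_iff, Set.mem_singleton_iff, Prod.mk.injEq] at this
    omega
  have hcn : P.pairing c i = n := by
    have := congrArg (P.coroot' i) hcroot
    simp only [map_sub, map_smul, root_coroot'_eq_pairing, pairing_same, hn', smul_eq_mul] at this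
    linarith
  have hcn' : 0 < P.pairingIn ℤ c i := by
    rw [← P.algebraMap_pairingIn ℤ] at hcn
    rw [algebraMap_int_eq, eq_intCast, Int.cast_inj] at hcn
    omega
  have hci : c ≠ i := by
    intro he
    rw [he, pairing_same] at hcn
    rw [he, ← hcn] at hcroot
    refine hji (P.root.injective ?_)
    rw [two_smul] at hcroot
    rw [eq_sub_iff_add_eq, add_left_cancel_iff] at hcroot
    exact hcroot
  obtain ⟨a, ha⟩ := P.root_sub_root_mem_of_pairingIn_pos hnpos hji
  obtain ⟨b, hb⟩ := P.root_sub_root_mem_of_pairingIn_pos hcn' hci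
  have key (a j : ι) (hj : j ∈ pos) (ha : P.root a = P.root j - P.root i) : a ∈ pos := by
    by_contra hc
    rw [← h.reflectionPerm_self_mem_iff] at hc
    exact hind j hj _ hc (by rw [root_reflectionPerm_self, ha]; abel)
  have hapos := key a j hj ha
  have hbpos := key b c hcpos hb
  have hab : P.root a + P.root b = (n - 2 : ℚ) • P.root i := by
    rw [ha, hb, hcroot]; module
  obtain hn1 | hn2 | hn3 : n = 1 ∨ n = 2 ∨ n = 3 := by omega
  · exact hind j hj c hcpos (by rw [hcroot, hn1]; simp)
  · refine h.sum_root_ne_zero {a, b} (by simp [hapos, hbpos]) (by simp) ?_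
    simp [hab, hn2]
  · exact hind a hapos b hbpos (by rw [hab, hn3]; norm_num)

lemma sum_pairing_eq_two_of_indecomposable [Finite ι] [P.IsCrystallographic] [P.IsReduced]
    (h : P.IsPositiveSystem pos) {i : ι} (hi : i ∈ pos)
    (hind : ∀ a ∈ pos, ∀ b ∈ pos, P.root i ≠ P.root a + P.root b) :
    ∑ j ∈ pos, P.pairing i j = 2 := by
  classical
  rw [← sum_filter_reflectionPerm_notMem (P := P) pos i (fun j ↦ P.pairing i j)
    (fun j ↦ by simp [P.pairing_reflectionPerm])]
  have : pos.filter (fun j ↦ P.reflectionPerm i j ∉ pos) = {i} := by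
    ext j
    simp only [Finset.mem_filter, Finset.mem_singleton]
    constructor
    · rintro ⟨hj, hij⟩
      by_contra hne
      exact hij (h.reflectionPerm_mem_of_indecomposable hi hind hj hne)
    · rintro rfl
      exact ⟨hi, h.reflectionPerm_self_notMem hi⟩
  simp [this]

lemma induction_add [Finite ι] [P.IsCrystallographic] (h : P.IsPositiveSystem pos) {p : ι → Prop}
    (indecomposable : ∀ i ∈ pos, (∀ a ∈ pos, ∀ b ∈ pos, P.root i ≠ P.root a + P.root b) → p i)
    (of_add : ∀ i j k, P.root k = P.root i + P.root j → p i → p j → p k) {i : ι} (hi : i ∈ pos) :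
    p i := by
  have hht (i : ι) (hi : i ∈ pos) : 0 < ∑ j ∈ pos, P.pairingIn ℤ i j := by
    have := h.flip.sum_pairing_pos hi
    simp only [pairing_flip, ← P.algebraMap_pairingIn ℤ] at this
    simp only [algebraMap_int_eq, eq_intCast] at this
    exact_mod_cast this
  induction hn : (∑ j ∈ pos, P.pairingIn ℤ i j).toNat using Nat.strong_induction_on
    generalizing i with
  | _ n ih =>
  by_cases hind : ∀ a ∈ pos, ∀ b ∈ pos, P.root i ≠ P.root a + P.root b
  · exact indecomposable i hi hind
  · push Not at hind
    obtain ⟨a, ha, b, hb, hab⟩ := hind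
    have hs : ∑ j ∈ pos, P.pairingIn ℤ i j =
        ∑ j ∈ pos, P.pairingIn ℤ a j + ∑ j ∈ pos, P.pairingIn ℤ b j := by
      rw [← Finset.sum_add_distrib]
      exact Finset.sum_congr rfl fun j _ ↦ P.pairingIn_eq_add_of_root_eq_add hab
    have h1 := hht a ha
    have h2 := hht b hb
    exact of_add a b i hab (ih _ (by omega) ha rfl) (ih _ (by omega) hb rfl)

lemma sum_pairing_eq_two_mul_int [Finite ι] [P.IsCrystallographic] [P.IsReduced]
    (h : P.IsPositiveSystem pos) {i : ι} (hi : i ∈ pos) :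
    ∃ z : ℤ, ∑ j ∈ pos, P.pairing i j = 2 * z := by
  refine h.induction_add (p := fun i ↦ ∃ z : ℤ, ∑ j ∈ pos, P.pairing i j = 2 * z)
    (fun i hi hind ↦ ⟨1, by simp [h.sum_pairing_eq_two_of_indecomposable hi hind]⟩) ?_ hi
  rintro i j k hk ⟨a, ha⟩ ⟨b, hb⟩
  refine ⟨a + b, ?_⟩
  simp only [P.pairing_eq_add_of_root_eq_add hk, Finset.sum_add_distrib, ha, hb]
  push_cast
  ring

end IsPositiveSystem

lemma reflectionPerm_self_reflectionPerm_self (P : RootPairing ι ℚ M N) (i : ι) :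
    P.reflectionPerm (P.reflectionPerm i i) (P.reflectionPerm i i) = i := by
  let := P.indexNeg
  exact neg_neg i

lemma reflectionPerm_reflectionPerm_self (P : RootPairing ι ℚ M N) (i j : ι) :
    P.reflectionPerm i (P.reflectionPerm j j) =
      P.reflectionPerm (P.reflectionPerm i j) (P.reflectionPerm i j) := by
  apply P.root.injective
  rw [root_reflectionPerm, root_reflectionPerm_self, root_reflectionPerm_self, map_neg,
    root_reflectionPerm]

/-- The half-sum of the coroots with index in a given finite set. -/
noncomputable def halfSumCoroot (P : RootPairing ι ℚ M N) (s : Finset ι) : N :=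
  (2⁻¹ : ℚ) • ∑ i ∈ s, P.coroot i

lemma toLinearMap_root_halfSumCoroot (P : RootPairing ι ℚ M N) (s : Finset ι) (i : ι) :
    P.toLinearMap (P.root i) (P.halfSumCoroot s) = 2⁻¹ * ∑ j ∈ s, P.pairing i j := by
  simp [halfSumCoroot]

/-- A set of indices containing exactly one root out of each pair of opposite roots. -/
def IsHalfSystem (P : RootPairing ι ℚ M N) (s : Finset ι) : Prop :=
  ∀ i, P.reflectionPerm i i ∈ s ↔ i ∉ s

lemma IsPositiveSystem.isHalfSystem {P : RootPairing ι ℚ M N} {pos : Finset ι}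
    (h : P.IsPositiveSystem pos) : P.IsHalfSystem pos :=
  h.reflectionPerm_self_mem_iff

lemma coreflection_halfSumCoroot (P : RootPairing ι ℚ M N) (s : Finset ι) (i : ι) :
    P.coreflection i (P.halfSumCoroot s) =
      P.halfSumCoroot (s.map (P.reflectionPerm i).toEmbedding) := by
  simp [halfSumCoroot, map_sum]

namespace IsHalfSystem

variable {P : RootPairing ι ℚ M N} {s t pos : Finset ι}

lemma map_reflectionPerm (hs : P.IsHalfSystem s) (i : ι) :
    P.IsHalfSystem (s.map (P.reflectionPerm i).toEmbedding) := by
  intro j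
  rw [Finset.mem_map_equiv, Finset.mem_map_equiv, reflectionPerm_symm,
    reflectionPerm_reflectionPerm_self, hs]

lemma sum_eq_sum_sub [DecidableEq ι] (hs : P.IsHalfSystem s) (ht : P.IsHalfSystem t) {A : Type*}
    [AddCommGroup A] (f : ι → A) (hf : ∀ i, f (P.reflectionPerm i i) = -f i) :
    ∑ i ∈ s, f i = ∑ i ∈ t, f i - 2 • ∑ i ∈ t \ s, f i := by
  have h1 := Finset.sum_inter_add_sum_sdiff s t f
  have h2 := Finset.sum_inter_add_sum_sdiff t s f
  have h3 : ∑ i ∈ s \ t, f i = -∑ i ∈ t \ s, f i := by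
    rw [← Finset.sum_neg_distrib]
    refine Finset.sum_nbij' (fun i ↦ P.reflectionPerm i i) (fun i ↦ P.reflectionPerm i i)
      ?_ ?_ ?_ ?_ ?_
    · intro i hi
      simpa [hs i, ht i, and_comm] using hi
    · intro i hi
      simpa [hs i, ht i, and_comm] using hi
    · simp [reflectionPerm_self_reflectionPerm_self]
    · simp [reflectionPerm_self_reflectionPerm_self]
    · simp [hf]
  rw [Finset.inter_comm] at h2
  rw [← h1, ← h2, h3]
  abel

lemma eq_of_pos [Finite ι] [P.IsCrystallographic] [P.IsReduced] (hs : P.IsHalfSystem s)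
    (h : P.IsPositiveSystem pos)
    (hdom : ∀ i ∈ pos, 0 < P.toLinearMap (P.root i) (P.halfSumCoroot s)) : s = pos := by
  classical
  have hsum (i : ι) : P.toLinearMap (P.root i) (P.halfSumCoroot s) =
      2⁻¹ * ∑ j ∈ pos, P.pairing i j - ∑ j ∈ pos \ s, P.pairing i j := by
    rw [toLinearMap_root_halfSumCoroot,
      hs.sum_eq_sum_sub h.isHalfSystem _ (fun j ↦ P.pairing_reflectionPerm_self_right i j)]
    rw [nsmul_eq_mul]
    push_cast
    ring
  have hle (i : ι) (hi : i ∈ pos) : ∑ j ∈ pos \ s, P.pairing i j ≤ 0 := by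
    refine h.induction_add (p := fun i ↦ ∑ j ∈ pos \ s, P.pairing i j ≤ 0) (fun i hi hind ↦ ?_)
      (fun i j k hk hi hj ↦ ?_) hi
    · have := hdom i hi
      rw [hsum, h.sum_pairing_eq_two_of_indecomposable hi hind] at this
      simp only [← P.algebraMap_pairingIn ℤ, algebraMap_int_eq, eq_intCast] at this ⊢
      norm_num at this
      norm_cast at this ⊢
      omega
    · simp only [P.pairing_eq_add_of_root_eq_add hk, Finset.sum_add_distrib]
      linarith
  have hzero : ∑ j ∈ pos \ s, ∑ i ∈ pos, P.pairing i j ≤ 0 := by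
    rw [Finset.sum_comm]
    exact Finset.sum_nonpos hle
  have hempty : pos \ s = ∅ := by
    by_contra hne
    have := Finset.sum_pos (s := pos \ s) (f := fun j ↦ ∑ i ∈ pos, P.pairing i j)
      (fun j hj ↦ h.sum_pairing_pos (Finset.mem_sdiff.1 hj).1)
      (Finset.nonempty_iff_ne_empty.2 hne)
    linarith
  have hsub : pos ⊆ s := Finset.sdiff_eq_empty_iff_subset.1 hempty
  refine (Finset.Subset.antisymm hsub fun i hi ↦ ?_).symm
  by_contra hc
  exact (hs i).1 (hsub ((h.isHalfSystem i).2 hc)) hi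

end IsHalfSystem

/-- The group of linear automorphisms generated by the reflections in the roots. -/
def reflectionGroup (P : RootPairing ι ℚ M N) : Subgroup (M ≃ₗ[ℚ] M) :=
  Subgroup.closure (Set.range P.reflection)

namespace reflectionGroup

variable (P : RootPairing ι ℚ M N)

lemma reflection_mem (i : ι) : P.reflection i ∈ P.reflectionGroup :=
  Subgroup.subset_closure ⟨i, rfl⟩

variable {P}

lemma induction {p : (M ≃ₗ[ℚ] M) → Prop} (one : p 1)
    (reflection_mul : ∀ i w, p w → p (P.reflection i * w)) {w : M ≃ₗ[ℚ] M}
    (hw : w ∈ P.reflectionGroup) : p w := by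
  refine Subgroup.closure_induction_left (p := fun w _ ↦ p w) one ?_ ?_ hw
  · rintro _ ⟨i, rfl⟩ w _ h
    exact reflection_mul i w h
  · rintro _ ⟨i, rfl⟩ w _ h
    rw [reflection_inv]
    exact reflection_mul i w h

lemma exists_root_eq {w : M ≃ₗ[ℚ] M} (hw : w ∈ P.reflectionGroup) (i : ι) :
    ∃ j, w (P.root i) = P.root j := by
  refine induction (P := P) (p := fun w ↦ ∃ j, w (P.root i) = P.root j) ⟨i, rfl⟩ ?_ hw
  rintro k w ⟨j, hj⟩
  exact ⟨P.reflectionPerm k j, by simp [hj]⟩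

instance [Finite ι] [P.IsRootSystem] : Finite P.reflectionGroup := by
  choose f hf using fun w : P.reflectionGroup ↦ exists_root_eq w.2
  refine Finite.of_injective f fun w w' h ↦ ?_
  apply Subtype.ext
  apply LinearEquiv.toLinearMap_injective
  refine LinearMap.ext_on_range (v := P.root) IsRootSystem.span_root_eq_top fun i ↦ ?_
  exact (hf w i).trans ((congrArg P.root (congrFun h i)).trans (hf w' i).symm)

lemma exists_int_eq {μ : M} (hμ : ∀ i, ∃ z : ℤ, P.toLinearMap μ (P.coroot i) = z)
    {w : M ≃ₗ[ℚ] M} (hw : w ∈ P.reflectionGroup) (i : ι) :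
    ∃ z : ℤ, P.toLinearMap (w μ) (P.coroot i) = z := by
  refine induction (P := P) (p := fun w ↦ ∀ i, ∃ z : ℤ, P.toLinearMap (w μ) (P.coroot i) = z)
    hμ (fun j w h i ↦ ?_) hw i
  obtain ⟨z, hz⟩ := h (P.reflectionPerm j i)
  exact ⟨z, (P.coroot'_reflection (i := j) (j := i) (w μ)).trans hz⟩

end reflectionGroup

lemma toLinearMap_coreflection (P : RootPairing ι ℚ M N) (i : ι) (x : M) (y : N) :
    P.toLinearMap x (P.coreflection i y) = P.toLinearMap (P.reflection i x) y := by
  simp [coreflection_apply, reflection_apply, mul_comm]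

lemma det_reflection [FiniteDimensional ℚ M] (P : RootPairing ι ℚ M N) (i : ι) :
    LinearMap.det (P.reflection i : M →ₗ[ℚ] M) = -1 := by
  have : (P.reflection i : M →ₗ[ℚ] M) = LinearMap.transvection (-P.coroot' i) (P.root i) := by
    ext x
    simp [reflection_apply, LinearMap.transvection, sub_eq_add_neg]
  rw [this, LinearMap.transvection.det]
  simp
  norm_num

/-- The determinant of a linear automorphism of a rational vector space, as a complex number. -/
noncomputable def detC (w : M ≃ₗ[ℚ] M) : ℂ :=
  ((LinearMap.det (w : M →ₗ[ℚ] M) : ℚ) : ℂ)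

lemma detC_one : detC (1 : M ≃ₗ[ℚ] M) = 1 := by
  have : ((1 : M ≃ₗ[ℚ] M) : M →ₗ[ℚ] M) = LinearMap.id := rfl
  rw [detC, this, LinearMap.det_id, Rat.cast_one]

lemma detC_reflection_mul [FiniteDimensional ℚ M] (P : RootPairing ι ℚ M N) (i : ι)
    (w : M ≃ₗ[ℚ] M) : detC (P.reflection i * w) = -detC w := by
  have : ((P.reflection i * w : M ≃ₗ[ℚ] M) : M →ₗ[ℚ] M) =
      (P.reflection i : M →ₗ[ℚ] M) ∘ₗ (w : M →ₗ[ℚ] M) := rfl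
  rw [detC, this, LinearMap.det_comp, det_reflection]
  simp [detC]

lemma detC_mul_self [FiniteDimensional ℚ M] (P : RootPairing ι ℚ M N) {w : M ≃ₗ[ℚ] M}
    (hw : w ∈ P.reflectionGroup) : detC w * detC w = 1 := by
  refine reflectionGroup.induction (P := P) (p := fun w ↦ detC w * detC w = 1) ?_
    (fun i w h ↦ ?_) hw
  · simp [detC_one]
  · simpa [detC_reflection_mul] using h

open PowerSeries in
/-- The expansion of `t ↦ exp (a t)` in powers of `t - 2πi/m`. -/
noncomputable def expSeries (m : ℕ) (a : ℚ) : ℂ⟦X⟧ :=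
  C (Complex.exp (a * (2 * Real.pi * Complex.I / m))) * rescale (a : ℂ) (PowerSeries.exp ℂ)

lemma expSeries_add (m : ℕ) (a b : ℚ) :
    expSeries m (a + b) = expSeries m a * expSeries m b := by
  rw [expSeries, expSeries, expSeries, mul_mul_mul_comm, PowerSeries.exp_mul_exp_eq_exp_add,
    ← map_mul, ← Complex.exp_add, Rat.cast_add, add_mul]

lemma expSeries_zero (m : ℕ) : expSeries m 0 = 1 := by
  simp [expSeries]

lemma expSeries_sum {κ : Type*} (m : ℕ) (s : Finset κ) (f : κ → ℚ) :
    expSeries m (∑ i ∈ s, f i) = ∏ i ∈ s, expSeries m (f i) := by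
  classical
  induction s using Finset.induction_on with
  | empty => simp [expSeries_zero]
  | insert i s hi ih => rw [Finset.sum_insert hi, Finset.prod_insert hi, expSeries_add, ih]

lemma coeff_expSeries (m : ℕ) (a : ℚ) (n : ℕ) :
    PowerSeries.coeff n (expSeries m a) =
      Complex.exp (a * (2 * Real.pi * Complex.I / m)) * a ^ n * (n.factorial : ℂ)⁻¹ := by
  rw [expSeries, PowerSeries.coeff_C_mul, PowerSeries.coeff_rescale, PowerSeries.coeff_exp]
  simp [mul_assoc]

lemma exp_eq_exp_add_int_mul {m : ℕ} (hm : 0 < m) (a : ℚ) (z : ℤ) :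
    Complex.exp (((a + m * z : ℚ) : ℂ) * (2 * Real.pi * Complex.I / m)) =
      Complex.exp (a * (2 * Real.pi * Complex.I / m)) := by
  rw [Complex.exp_eq_exp_iff_exists_int]
  refine ⟨z, ?_⟩
  have : (m : ℂ) ≠ 0 := by exact_mod_cast hm.ne'
  push_cast
  field_simp

/-- The expansion of `t ↦ 2 sinh (a t / 2)` in powers of `t - 2πi/m`. -/
noncomputable def sinhSeries (m : ℕ) (a : ℚ) : PowerSeries ℂ :=
  expSeries m (a / 2) - expSeries m (-(a / 2))

lemma sinhSeries_neg (m : ℕ) (a : ℚ) : sinhSeries m (-a) = -sinhSeries m a := by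
  simp [sinhSeries, neg_div]

lemma order_sinhSeries {m : ℕ} (hm : 0 < m) {a : ℚ} {z : ℤ} (ha : a = z) (h0 : a ≠ 0) :
    (sinhSeries m a).order = if (m : ℤ) ∣ z then 1 else 0 := by
  have hm' : (m : ℂ) ≠ 0 := by exact_mod_cast hm.ne'
  have hpi : (Real.pi : ℂ) ≠ 0 := by exact_mod_cast Real.pi_ne_zero
  have key : PowerSeries.coeff 0 (sinhSeries m a) = 0 ↔ (m : ℤ) ∣ z := by
    simp only [sinhSeries, map_sub, coeff_expSeries, sub_eq_zero, pow_zero, Nat.factorial_zero,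
      Nat.cast_one, inv_one, mul_one]
    rw [Complex.exp_eq_exp_iff_exists_int]
    constructor
    · rintro ⟨n, hn⟩
      refine ⟨n, ?_⟩
      rw [ha] at hn
      push_cast at hn
      field_simp at hn
      have : (z : ℂ) = m * n := by linear_combination (1 / 2) * hn
      exact_mod_cast this
    · rintro ⟨n, rfl⟩
      refine ⟨n, ?_⟩
      rw [ha]
      push_cast
      field_simp
      ring
  split_ifs with hz
  · rw [← Nat.cast_one, PowerSeries.order_eq_nat]
    refine ⟨?_, fun i hi ↦ ?_⟩
    · have h1 := key.2 hz
      simp only [sinhSeries, map_sub, coeff_expSeries, sub_eq_zero, pow_zero, Nat.factorial_zero,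
        Nat.cast_one, inv_one, mul_one] at h1
      simp only [sinhSeries, map_sub, coeff_expSeries, ← h1]
      have : (a : ℂ) ≠ 0 := by exact_mod_cast h0
      have h2 := Complex.exp_ne_zero (((a / 2 : ℚ) : ℂ) * (2 * Real.pi * Complex.I / m))
      rw [← sub_mul, ← mul_sub]
      simpa [← two_mul] using this
    · obtain rfl : i = 0 := by omega
      exact key.2 hz
  · rw [← Nat.cast_zero, PowerSeries.order_eq_nat]
    exact ⟨fun h ↦ hz (key.1 h), by simp⟩

noncomputable instance [Finite ι] (P : RootPairing ι ℚ M N) [P.IsRootSystem] :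
    Fintype P.reflectionGroup :=
  Fintype.ofFinite _

/-- The alternating sum of the exponentials `t ↦ exp (⟨w μ, ν⟩ t)` over the elements `w` of the
reflection group, expanded in powers of `t - 2πi/m`. -/
noncomputable def altSum [Finite ι] (P : RootPairing ι ℚ M N) [P.IsRootSystem] (m : ℕ) (μ : M)
    (ν : N) : PowerSeries ℂ :=
  ∑ w : P.reflectionGroup,
    PowerSeries.C (detC w.1) * expSeries m (P.toLinearMap (w.1 μ) ν)

section AltSum

variable [Finite ι] {P : RootPairing ι ℚ M N} [P.IsRootSystem]

lemma sum_reflectionGroup_reflection_mul {A : Type*} [AddCommMonoid A] (i : ι)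
    (f : (M ≃ₗ[ℚ] M) → A) :
    ∑ w : P.reflectionGroup, f (P.reflection i * w.1) = ∑ w : P.reflectionGroup, f w.1 :=
  Fintype.sum_equiv (Equiv.mulLeft ⟨P.reflection i, reflectionGroup.reflection_mem P i⟩) _ _
    fun _ ↦ rfl

lemma altSum_coreflection [FiniteDimensional ℚ M] (m : ℕ) (μ : M) (ν : N) (i : ι) :
    P.altSum m μ (P.coreflection i ν) = -P.altSum m μ ν := by
  rw [altSum, altSum, ← Finset.sum_neg_distrib, ← sum_reflectionGroup_reflection_mul i
    fun w ↦ -(PowerSeries.C (detC w) * expSeries m (P.toLinearMap (w μ) ν))]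
  refine Finset.sum_congr rfl fun w _ ↦ ?_
  rw [detC_reflection_mul, toLinearMap_coreflection, map_neg, neg_mul, neg_neg]
  rfl

lemma altSum_eq_zero [FiniteDimensional ℚ M] (m : ℕ) (μ : M) {ν : N} {i : ι}
    (h : P.toLinearMap (P.root i) ν = 0) : P.altSum m μ ν = 0 := by
  have h1 := altSum_coreflection (P := P) m μ ν i
  have h2 : P.coreflection i ν = ν := by
    rw [coreflection_apply]
    simpa using Or.inl h
  rw [h2] at h1
  ext n
  have h3 := congrArg (PowerSeries.coeff n) h1
  rw [map_neg, self_eq_neg] at h3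
  rw [h3, map_zero]

lemma exists_altSum_halfSumCoroot_eq [FiniteDimensional ℚ M] [P.IsCrystallographic] [P.IsReduced]
    {pos : Finset ι} (h : P.IsPositiveSystem pos) (m : ℕ) (μ : M) {t : Finset ι}
    (ht : P.IsHalfSystem t) :
    ∃ c : ℂ, P.altSum m μ (P.halfSumCoroot t) =
      PowerSeries.C c * P.altSum m μ (P.halfSumCoroot pos) := by
  classical
  have := Fintype.ofFinite ι
  by_contra hc
  let bad : Finset (Finset ι) := Finset.univ.filter fun t ↦ P.IsHalfSystem t ∧
    ¬∃ c : ℂ, P.altSum m μ (P.halfSumCoroot t) =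
      PowerSeries.C c * P.altSum m μ (P.halfSumCoroot pos)
  obtain ⟨t, ht, hmax⟩ := bad.exists_max_image
    (fun t ↦ P.toLinearMap (∑ j ∈ pos, P.root j) (P.halfSumCoroot t)) ⟨t, by
      rw [Finset.mem_filter]
      exact ⟨Finset.mem_univ t, ht, hc⟩⟩
  simp only [bad, Finset.mem_filter, Finset.mem_univ, true_and] at ht hmax
  obtain ⟨ht, hbad⟩ := ht
  by_cases hdom : ∀ i ∈ pos, 0 < P.toLinearMap (P.root i) (P.halfSumCoroot t)
  · exact hbad ⟨1, by rw [ht.eq_of_pos h hdom, map_one, one_mul]⟩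
  push Not at hdom
  obtain ⟨i, hi, hle⟩ := hdom
  rcases hle.eq_or_lt with h0 | hlt
  · exact hbad ⟨0, by rw [altSum_eq_zero m μ h0, map_zero, zero_mul]⟩
  have hbad' : ¬∃ c : ℂ, P.altSum m μ (P.coreflection i (P.halfSumCoroot t)) =
      PowerSeries.C c * P.altSum m μ (P.halfSumCoroot pos) := by
    rintro ⟨c, hc⟩
    refine hbad ⟨-c, ?_⟩
    rw [altSum_coreflection, neg_eq_iff_eq_neg] at hc
    rw [hc, map_neg, neg_mul]
  rw [coreflection_halfSumCoroot] at hbad'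
  have hle := hmax _ ⟨ht.map_reflectionPerm i, hbad'⟩
  rw [← coreflection_halfSumCoroot, coreflection_apply, map_sub, map_smul] at hle
  have hpos : 0 < P.toLinearMap (∑ j ∈ pos, P.root j) (P.coroot i) := by
    simpa [map_sum] using h.sum_pairing_pos hi
  have : 0 < -(P.root' i (P.halfSumCoroot t)) * P.toLinearMap (∑ j ∈ pos, P.root j) (P.coroot i) :=
    mul_pos (neg_pos.2 hlt) hpos
  rw [smul_eq_mul] at hle
  linarith

end AltSum

lemma IsPositiveSystem.prod_reflectionPerm [Finite ι] {P : RootPairing ι ℚ M N}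
    [P.IsCrystallographic] [P.IsReduced] {pos : Finset ι} (h : P.IsPositiveSystem pos) {A : Type*}
    [CommRing A] {f : ι → A} (hf : ∀ i, f (P.reflectionPerm i i) = -f i) (i : ι) :
    ∏ j ∈ pos, f (P.reflectionPerm i j) = -∏ j ∈ pos, f j := by
  classical
  wlog hi : i ∈ pos generalizing i
  · rw [← this _ ((h.reflectionPerm_self_mem_iff i).2 hi)]
    refine Finset.prod_congr rfl fun j _ ↦ congrArg f (P.root.injective ?_)
    simp [reflection_apply]
    module
  have hsub (j : ι) : P.reflectionPerm i (P.reflectionPerm i j) = j :=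
    P.reflectionPerm_involutive i j
  have hpos (j : ι) (hj : P.reflectionPerm i j ∉ pos) :
      P.reflectionPerm (P.reflectionPerm i j) (P.reflectionPerm i j) ∈ pos :=
    (h.reflectionPerm_self_mem_iff _).2 hj
  let neg (j : ι) : ι := P.reflectionPerm (P.reflectionPerm i j) (P.reflectionPerm i j)
  have hneg (j : ι) : P.reflectionPerm i (neg j) = P.reflectionPerm j j := by
    simp only [neg]
    rw [reflectionPerm_reflectionPerm_self, hsub]
  have hnegneg (j : ι) : neg (neg j) = j := by
    change P.reflectionPerm (P.reflectionPerm i (neg j)) (P.reflectionPerm i (neg j)) = j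
    rw [hneg, reflectionPerm_self_reflectionPerm_self]
  let s := pos.filter fun j ↦ P.reflectionPerm i j ∉ pos
  have hs (j : ι) (hj : j ∈ s) : neg j ∈ s := by
    simp only [s, Finset.mem_filter] at hj ⊢
    refine ⟨hpos j hj.2, ?_⟩
    rw [hneg]
    exact h.reflectionPerm_self_notMem hj.1
  have his : i ∈ s := Finset.mem_filter.2 ⟨hi, h.reflectionPerm_self_notMem hi⟩
  have hfix (j : ι) (hj : j ∈ pos) (hji : neg j = j) : j = i := by
    have h1 := congrArg P.root hji
    simp only [neg, root_reflectionPerm_self, root_reflectionPerm, reflection_apply_root] at h1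
    have h2 : ¬ LinearIndependent ℚ ![P.root j, P.root i] := by
      rw [LinearIndependent.pair_iff]
      push Not
      refine ⟨2, -P.pairing j i, ?_, by simp⟩
      rw [two_smul]
      nth_rewrite 1 [← h1]
      module
    rcases IsReduced.eq_or_eq_neg j i h2 with h3 | h3
    · exact P.root.injective h3
    · rw [← root_reflectionPerm_self, P.root.injective.eq_iff] at h3
      exact absurd hj (h3 ▸ h.reflectionPerm_self_notMem hi)
  have hsign : ∏ _j ∈ s.erase i, (-1 : A) = 1 := by
    refine Finset.prod_involution (fun j _ ↦ neg j) (fun _ _ ↦ by simp) ?_ ?_ ?_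
    · intro j hj _ hji
      rw [Finset.mem_erase] at hj
      exact hj.1 (hfix j (Finset.mem_filter.1 hj.2).1 hji)
    · intro j hj
      rw [Finset.mem_erase] at hj ⊢
      refine ⟨fun hji ↦ hj.1 ?_, hs j hj.2⟩
      rw [← hnegneg j, hji]
      exact P.reflectionPerm_self_reflectionPerm_self i
    · intro j _
      exact hnegneg j
  have h1 : ∏ j ∈ s, f (P.reflectionPerm i j) = -∏ j ∈ s, f j := by
    have : ∏ j ∈ s, f (neg j) = ∏ j ∈ s, f j :=
      Finset.prod_nbij' neg neg hs hs (fun j _ ↦ hnegneg j) (fun j _ ↦ hnegneg j) fun _ _ ↦ rfl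
    have hsign' : ∏ _j ∈ s, (-1 : A) = -1 := by
      rw [← Finset.prod_erase_mul _ _ his, hsign, one_mul]
    rw [← this, ← neg_one_mul, ← hsign', ← Finset.prod_mul_distrib]
    refine Finset.prod_congr rfl fun j _ ↦ ?_
    rw [hf, neg_one_mul, neg_neg]
  have h2 : ∏ j ∈ pos with ¬P.reflectionPerm i j ∉ pos, f (P.reflectionPerm i j) =
      ∏ j ∈ pos with ¬P.reflectionPerm i j ∉ pos, f j := by
    refine Finset.prod_nbij' (P.reflectionPerm i) (P.reflectionPerm i) ?_ ?_ (fun j _ ↦ hsub j)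
      (fun j _ ↦ hsub j) fun _ _ ↦ rfl <;>
    · intro j hj
      simp only [not_not, Finset.mem_filter] at hj ⊢
      exact ⟨hj.2, (hsub j).symm ▸ hj.1⟩
  rw [← Finset.prod_filter_mul_prod_filter_not pos (fun j ↦ P.reflectionPerm i j ∉ pos),
    ← Finset.prod_filter_mul_prod_filter_not pos (fun j ↦ P.reflectionPerm i j ∉ pos) f, h2]
  exact (congrArg (· * _) h1).trans (neg_mul _ _)

/-- The Weyl product `∏ 2 sinh (⟨μ, α∨⟩ t / 2)` over the roots `α` with index in `pos`, expanded in
powers of `t - 2πi/m`. -/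
noncomputable def weylProd (P : RootPairing ι ℚ M N) (m : ℕ) (pos : Finset ι) (μ : M) :
    PowerSeries ℂ :=
  ∏ i ∈ pos, sinhSeries m (P.toLinearMap μ (P.coroot i))

/-- The half system obtained from `pos` by replacing the members of `s` by their opposites. -/
def negOn [DecidableEq ι] (P : RootPairing ι ℚ M N) (pos s : Finset ι) : Finset ι :=
  (pos \ s) ∪ s.image fun i ↦ P.reflectionPerm i i

section WeylProd

variable {P : RootPairing ι ℚ M N} {pos : Finset ι}

lemma mem_negOn [DecidableEq ι] {s : Finset ι} {i : ι} :
    i ∈ P.negOn pos s ↔ (i ∈ pos ∧ i ∉ s) ∨ P.reflectionPerm i i ∈ s := by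
  simp only [negOn, Finset.mem_union, Finset.mem_sdiff, Finset.mem_image]
  refine or_congr_right ⟨?_, fun h ↦ ⟨_, h, P.reflectionPerm_self_reflectionPerm_self i⟩⟩
  rintro ⟨j, hj, rfl⟩
  rwa [reflectionPerm_self_reflectionPerm_self]

lemma IsHalfSystem.negOn [DecidableEq ι] (h : P.IsHalfSystem pos) {s : Finset ι} (hs : s ⊆ pos) :
    P.IsHalfSystem (P.negOn pos s) := by
  intro i
  have h1 := h i
  have h2 := @hs i
  have h3 := @hs (P.reflectionPerm i i)
  rw [mem_negOn, mem_negOn, reflectionPerm_self_reflectionPerm_self]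
  tauto

lemma IsHalfSystem.halfSumCoroot_negOn [DecidableEq ι] (h : P.IsHalfSystem pos) {s : Finset ι}
    (hs : s ⊆ pos) :
    P.halfSumCoroot (P.negOn pos s) =
      ∑ i ∈ pos \ s, (2⁻¹ : ℚ) • P.coroot i + ∑ i ∈ s, -((2⁻¹ : ℚ) • P.coroot i) := by
  rw [halfSumCoroot, RootPairing.negOn, Finset.sum_union, Finset.sum_image, smul_add,
    Finset.smul_sum, Finset.smul_sum]
  · simp
  · intro i _ j _ hij
    rw [← P.reflectionPerm_self_reflectionPerm_self i,
      ← P.reflectionPerm_self_reflectionPerm_self j]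
    simp only at hij
    rw [hij]
  · rw [Finset.disjoint_left]
    intro i hi hi'
    obtain ⟨j, hj, rfl⟩ := Finset.mem_image.1 hi'
    exact (h j).1 (Finset.mem_sdiff.1 hi).1 (hs hj)

lemma weylProd_eq_sum [DecidableEq ι] (h : P.IsHalfSystem pos) (m : ℕ) (μ : M) :
    P.weylProd m pos μ = ∑ s ∈ pos.powerset,
      (-1) ^ s.card * expSeries m (P.toLinearMap μ (P.halfSumCoroot (P.negOn pos s))) := by
  rw [weylProd]
  simp only [sinhSeries]
  rw [Finset.prod_sub]
  refine Finset.sum_congr rfl fun s hs ↦ ?_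
  rw [h.halfSumCoroot_negOn (Finset.mem_powerset.1 hs), map_add, map_sum, map_sum, expSeries_add,
    expSeries_sum, expSeries_sum]
  simp [div_eq_inv_mul, mul_assoc]

lemma weylProd_reflection [Finite ι] [P.IsCrystallographic] [P.IsReduced]
    (h : P.IsPositiveSystem pos) (m : ℕ) (i : ι) (μ : M) :
    P.weylProd m pos (P.reflection i μ) = -P.weylProd m pos μ := by
  rw [weylProd, weylProd, ← h.prod_reflectionPerm (i := i)]
  · exact Finset.prod_congr rfl fun j _ ↦
      congrArg (sinhSeries m) (P.coroot'_reflection (i := i) (j := j) μ)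
  · intro j
    simp [sinhSeries_neg]

lemma weylProd_apply [Finite ι] [FiniteDimensional ℚ M] [P.IsCrystallographic] [P.IsReduced]
    (h : P.IsPositiveSystem pos) (m : ℕ) (μ : M) {w : M ≃ₗ[ℚ] M} (hw : w ∈ P.reflectionGroup) :
    P.weylProd m pos (w μ) = PowerSeries.C (detC w) * P.weylProd m pos μ := by
  refine reflectionGroup.induction (P := P)
    (p := fun w ↦ P.weylProd m pos (w μ) = PowerSeries.C (detC w) * P.weylProd m pos μ) ?_
    (fun i w hw ↦ ?_) hw
  · simp [detC_one]
  · rw [detC_reflection_mul, map_neg, neg_mul, ← hw]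
    exact weylProd_reflection h m i (w μ)

lemma exists_card_mul_weylProd_eq [Finite ι] [FiniteDimensional ℚ M] [P.IsCrystallographic]
    [P.IsReduced] [P.IsRootSystem] (h : P.IsPositiveSystem pos) (m : ℕ) (μ : M) :
    ∃ c : ℂ, (Fintype.card P.reflectionGroup : PowerSeries ℂ) * P.weylProd m pos μ =
      PowerSeries.C c * P.altSum m μ (P.halfSumCoroot pos) := by
  classical
  choose! c hc using fun t ht ↦ exists_altSum_halfSumCoroot_eq h m μ (t := t) ht
  refine ⟨∑ s ∈ pos.powerset, (-1) ^ s.card * c (P.negOn pos s), ?_⟩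
  calc (Fintype.card P.reflectionGroup : PowerSeries ℂ) * P.weylProd m pos μ
      = ∑ w : P.reflectionGroup, PowerSeries.C (detC w.1) * P.weylProd m pos (w.1 μ) := by
        simp only [fun w : P.reflectionGroup ↦ weylProd_apply h m μ w.2, ← mul_assoc, ← map_mul,
          fun w : P.reflectionGroup ↦ detC_mul_self P w.2]
        simp
    _ = ∑ s ∈ pos.powerset, (-1) ^ s.card * P.altSum m μ (P.halfSumCoroot (P.negOn pos s)) := by
        simp only [weylProd_eq_sum h.isHalfSystem, altSum, Finset.mul_sum]
        rw [Finset.sum_comm]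
        simp only [mul_left_comm]
    _ = _ := by
        rw [map_sum, Finset.sum_mul]
        refine Finset.sum_congr rfl fun s hs ↦ ?_
        rw [hc _ (h.isHalfSystem.negOn (Finset.mem_powerset.1 hs))]
        simp [mul_assoc]

end WeylProd

section Vanishing

variable {P : RootPairing ι ℚ M N} {pos : Finset ι}

lemma exists_forall_toLinearMap_ne_zero {κ : Type*} [Finite κ] (P : RootPairing ι ℚ M N)
    (x : κ → M) (hx : ∀ k, x k ≠ 0) : ∃ v : N, ∀ k, P.toLinearMap (x k) v ≠ 0 := by
  refine Module.Dual.exists_forall_ne_zero_of_forall_exists (fun k ↦ P.toLinearMap (x k))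
    fun k ↦ ?_
  by_contra! hc
  refine hx k (LinearMap.IsPerfPair.bijective_left P.toLinearMap |>.injective ?_)
  rw [map_zero]
  exact LinearMap.ext hc

lemma IsPositiveSystem.exists_mul_ne_mul [P.IsReduced] (h : P.IsPositiveSystem pos) {y : N}
    (hy : ∀ i ∈ pos, P.toLinearMap (P.root i) y ≠ 0) :
    ∃ v : N, (∀ i ∈ pos, P.toLinearMap (P.root i) v ≠ 0) ∧
      ∀ i ∈ pos, ∀ j ∈ pos, i ≠ j →
        P.toLinearMap (P.root i) y * P.toLinearMap (P.root j) v ≠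
          P.toLinearMap (P.root j) y * P.toLinearMap (P.root i) v := by
  classical
  obtain ⟨v, hv⟩ := exists_forall_toLinearMap_ne_zero P (κ := pos × pos)
    (fun k ↦ if k.1 = k.2 then P.root k.1 else
      P.toLinearMap (P.root k.1) y • P.root k.2 - P.toLinearMap (P.root k.2) y • P.root k.1) (by
    rintro ⟨⟨i, hi⟩, ⟨j, hj⟩⟩
    split_ifs with hij
    · exact P.ne_zero i
    · intro hc
      have h2 : ¬ LinearIndependent ℚ ![P.root j, P.root i] := by
        rw [LinearIndependent.pair_iff]
        intro hl
        refine hy i hi (hl (P.toLinearMap (P.root i) y) (-P.toLinearMap (P.root j) y) ?_).1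
        rw [neg_smul, ← sub_eq_add_neg]
        exact hc
      rcases IsReduced.eq_or_eq_neg j i h2 with h3 | h3
      · exact hij (Subtype.ext (P.root.injective h3.symm))
      · rw [← root_reflectionPerm_self, P.root.injective.eq_iff] at h3
        exact h.reflectionPerm_self_notMem hi (h3 ▸ hj))
  refine ⟨v, fun i hi ↦ by simpa using hv (⟨i, hi⟩, ⟨i, hi⟩), fun i hi j hj hij hc ↦ ?_⟩
  refine hv (⟨i, hi⟩, ⟨j, hj⟩) ?_
  simp only [Subtype.mk.injEq, hij, if_false, map_sub, map_smul, LinearMap.sub_apply,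
    LinearMap.smul_apply, smul_eq_mul]
  rw [hc, sub_self]

/-- A sum over the reflection group weighted by determinants vanishes as soon as the summand is
invariant under left multiplication by a reflection. -/
lemma sum_detC_mul_eq_zero [Finite ι] [FiniteDimensional ℚ M] [P.IsRootSystem] (i : ι)
    (f : (M ≃ₗ[ℚ] M) → ℂ) (hf : ∀ w ∈ P.reflectionGroup, f (P.reflection i * w) = f w) :
    ∑ w : P.reflectionGroup, detC w.1 * f w.1 = 0 := by
  have h1 := sum_reflectionGroup_reflection_mul (P := P) i fun w ↦ detC w * f w
  have h2 : ∑ w : P.reflectionGroup, detC (P.reflection i * w.1) * f (P.reflection i * w.1) =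
      -∑ w : P.reflectionGroup, detC w.1 * f w.1 := by
    rw [← Finset.sum_neg_distrib]
    refine Finset.sum_congr rfl fun w _ ↦ ?_
    rw [detC_reflection_mul, hf w.1 w.2, neg_mul]
  exact self_eq_neg.1 (h1.symm.trans h2)

lemma IsPositiveSystem.X_pow_dvd_altSum [Finite ι] [FiniteDimensional ℚ M] [P.IsRootSystem]
    [P.IsReduced] (h : P.IsPositiveSystem pos) {m : ℕ} (hm : 0 < m) {μ : M}
    (hμ : ∀ i, ∃ z : ℤ, P.toLinearMap μ (P.coroot i) = z) {y : N}
    (hy : ∀ i ∈ pos, P.toLinearMap (P.root i) y ≠ 0) {s : Finset ι} (hs : s ⊆ pos)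
    (hsm : ∀ i ∈ s, ∃ z : ℤ, P.toLinearMap (P.root i) y = m * z) :
    PowerSeries.X ^ s.card ∣ P.altSum m μ y := by
  rw [PowerSeries.X_pow_dvd_iff]
  intro n hn
  obtain ⟨v, hv, hyv⟩ := h.exists_mul_ne_mul hy
  let e (w : M ≃ₗ[ℚ] M) : ℂ :=
    Complex.exp (P.toLinearMap (w μ) y * (2 * Real.pi * Complex.I / m))
  have he (i : ι) (hi : i ∈ s) (w : M ≃ₗ[ℚ] M) (hw : w ∈ P.reflectionGroup) :
      e (P.reflection i * w) = e w := by
    obtain ⟨z, hz⟩ := hsm i hi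
    obtain ⟨z', hz'⟩ := reflectionGroup.exists_int_eq hμ hw i
    have : P.toLinearMap ((P.reflection i * w) μ) y =
        P.toLinearMap (w μ) y + m * ((-(z' * z) : ℤ) : ℚ) := by
      change P.toLinearMap (P.reflection i (w μ)) y = _
      rw [reflection_apply, map_sub, map_smul, LinearMap.sub_apply, LinearMap.smul_apply, hz,
        smul_eq_mul]
      change _ - P.toLinearMap (w μ) (P.coroot i) * _ = _
      rw [hz']
      push_cast
      ring
    simp only [e]
    rw [this, exp_eq_exp_add_int_mul hm]
  let t (i : ι) : ℚ := -P.toLinearMap (P.root i) y / P.toLinearMap (P.root i) v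
  have ht (i : ι) (hi : i ∈ s) (w : M ≃ₗ[ℚ] M) :
      P.toLinearMap ((P.reflection i * w) μ) (y + t i • v) =
        P.toLinearMap (w μ) (y + t i • v) := by
    change P.toLinearMap (P.reflection i (w μ)) _ = _
    rw [← toLinearMap_coreflection, coreflection_apply]
    have h0 : P.root' i (y + t i • v) = 0 := by
      change P.toLinearMap (P.root i) _ = 0
      have := hv i (hs hi)
      rw [map_add, map_smul, smul_eq_mul, div_mul_cancel₀ _ this, add_neg_cancel]
    rw [h0, zero_smul, sub_zero]
  let q : Polynomial ℂ := ∑ w : P.reflectionGroup, Polynomial.C (detC w.1 * e w.1) *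
    (Polynomial.C ((P.toLinearMap (w.1 μ) v : ℚ) : ℂ) * Polynomial.X +
      Polynomial.C ((P.toLinearMap (w.1 μ) y : ℚ) : ℂ)) ^ n
  have hdeg : q.natDegree ≤ n := by
    refine Polynomial.natDegree_sum_le_of_forall_le _ _ fun w _ ↦ ?_
    refine (Polynomial.natDegree_C_mul_le _ _).trans ?_
    refine (Polynomial.natDegree_pow_le_of_le n Polynomial.natDegree_linear_le).trans_eq ?_
    rw [mul_one]
  have hq : q = 0 := by
    refine Polynomial.eq_zero_of_natDegree_lt_card_of_eval_eq_zero q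
      (f := fun i : s ↦ (t i : ℂ)) ?_ ?_ ?_
    · rintro ⟨i, hi⟩ ⟨j, hj⟩ hij
      by_contra hne
      refine hyv i (hs hi) j (hs hj) (fun hc ↦ hne (Subtype.ext hc)) ?_
      have hij' : t i = t j := Rat.cast_injective (α := ℂ) hij
      simp only [t] at hij'
      rw [div_eq_div_iff (hv i (hs hi)) (hv j (hs hj))] at hij'
      linarith
    · rintro ⟨i, hi⟩
      rw [← sum_detC_mul_eq_zero (P := P) i
        (fun w ↦ e w * ((P.toLinearMap (w μ) (y + t i • v) : ℚ) : ℂ) ^ n)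
        fun w hw ↦ by rw [he i hi w hw, ht i hi w]]
      rw [Polynomial.eval_finsetSum]
      refine Finset.sum_congr rfl fun w _ ↦ ?_
      simp
      ring
    · simpa using hdeg.trans_lt hn
  have hq0 := congrArg (Polynomial.eval 0) hq
  rw [Polynomial.eval_finsetSum] at hq0
  simp only [altSum, map_sum, PowerSeries.coeff_C_mul, coeff_expSeries]
  have : ∑ w : P.reflectionGroup, detC w.1 * e w.1 *
      ((P.toLinearMap (w.1 μ) y : ℚ) : ℂ) ^ n = 0 := by
    simpa using hq0
  rw [← zero_mul ((n.factorial : ℂ)⁻¹), ← this, Finset.sum_mul]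
  refine Finset.sum_congr rfl fun w _ ↦ ?_
  simp only [e]
  ring

end Vanishing

open scoped Classical in
/-- For a regular integral weight `μ`, the number of positive coroots whose pairing with `μ` is
divisible by `m` is at least the number of positive roots of height divisible by `m`. -/
theorem IsPositiveSystem.card_filter_height_le [Finite ι] [FiniteDimensional ℚ M]
    {P : RootPairing ι ℚ M N} {pos : Finset ι} [P.IsRootSystem] [P.IsCrystallographic]
    [P.IsReduced] (h : P.IsPositiveSystem pos) {m : ℕ} (hm : 0 < m) {μ : M}
    (hμ : ∀ i, ∃ z : ℤ, P.toLinearMap μ (P.coroot i) = z)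
    (hμ0 : ∀ i ∈ pos, P.toLinearMap μ (P.coroot i) ≠ 0) :
    (pos.filter fun i ↦ ∃ z : ℤ, P.toLinearMap (P.root i) (P.halfSumCoroot pos) = m * z).card ≤
      (pos.filter fun i ↦ ∃ z : ℤ, P.toLinearMap μ (P.coroot i) = m * z).card := by
  have hy (i : ι) (hi : i ∈ pos) : P.toLinearMap (P.root i) (P.halfSumCoroot pos) ≠ 0 := by
    rw [toLinearMap_root_halfSumCoroot]
    exact (mul_pos (by norm_num) (h.flip.sum_pairing_pos hi)).ne'
  obtain ⟨c, hc⟩ := exists_card_mul_weylProd_eq h m μ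
  have hdvd : PowerSeries.X ^ (pos.filter fun i ↦ ∃ z : ℤ,
      P.toLinearMap (P.root i) (P.halfSumCoroot pos) = m * z).card ∣ P.weylProd m pos μ := by
    have h1 := (h.X_pow_dvd_altSum hm hμ hy (Finset.filter_subset (fun i ↦ ∃ z : ℤ,
      P.toLinearMap (P.root i) (P.halfSumCoroot pos) = m * z) pos)
      fun i hi ↦ (Finset.mem_filter.1 hi).2).mul_left (PowerSeries.C c)
    rw [← hc] at h1
    refine (IsUnit.dvd_mul_left ?_).1 h1
    rw [PowerSeries.isUnit_iff_constantCoeff, map_natCast, isUnit_iff_ne_zero]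
    exact_mod_cast Fintype.card_ne_zero
  rw [PowerSeries.X_pow_dvd_iff] at hdvd
  have hle := PowerSeries.nat_le_order _ _ hdvd
  rw [weylProd, PowerSeries.order_prod] at hle
  choose z hz using hμ
  rw [Finset.sum_congr rfl fun i hi ↦ order_sinhSeries hm (hz i) (hμ0 i hi)] at hle
  rw [← Finset.sum_filter, Finset.sum_const, nsmul_one, Nat.cast_le] at hle
  refine hle.trans (Finset.card_le_card fun i hi ↦ ?_)
  obtain ⟨hi, k, hk⟩ := Finset.mem_filter.1 hi
  exact Finset.mem_filter.2 ⟨hi, k, by rw [hz, hk]; push_cast; rfl⟩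

open scoped Classical in
/-- For a regular integral weight `μ`, the number of positive coroots whose pairing with `μ` is
divisible by `m` is at least the corresponding number for the half-sum of the positive roots. -/
theorem IsPositiveSystem.card_filter_halfSum_le [Finite ι] [FiniteDimensional ℚ M]
    [FiniteDimensional ℚ N] {P : RootPairing ι ℚ M N} {pos : Finset ι} [P.IsRootSystem]
    [P.IsCrystallographic] [P.IsReduced] (h : P.IsPositiveSystem pos) {m : ℕ} (hm : 0 < m) {μ : M}
    (hμ : ∀ i, ∃ z : ℤ, P.toLinearMap μ (P.coroot i) = z)
    (hμ0 : ∀ i ∈ pos, P.toLinearMap μ (P.coroot i) ≠ 0) :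
    (pos.filter fun i ↦ ∃ z : ℤ, P.toLinearMap (P.flip.halfSumCoroot pos) (P.coroot i) =
        m * z).card ≤
      (pos.filter fun i ↦ ∃ z : ℤ, P.toLinearMap μ (P.coroot i) = m * z).card := by
  have hpos (i : ι) (hi : i ∈ pos) : P.toLinearMap (P.root i) (P.halfSumCoroot pos) ≠ 0 := by
    rw [toLinearMap_root_halfSumCoroot]
    exact (mul_pos (by norm_num) (h.flip.sum_pairing_pos hi)).ne'
  have hint (i : ι) (hi : i ∈ pos) :
      ∃ z : ℤ, P.toLinearMap (P.root i) (P.halfSumCoroot pos) = z := by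
    obtain ⟨z, hz⟩ := h.sum_pairing_eq_two_mul_int hi
    exact ⟨z, by rw [toLinearMap_root_halfSumCoroot, hz]; ring⟩
  have hint' (i : ι) : ∃ z : ℤ, P.toLinearMap (P.root i) (P.halfSumCoroot pos) = z := by
    by_cases hi : i ∈ pos
    · exact hint i hi
    · obtain ⟨z, hz⟩ := hint _ ((h.reflectionPerm_self_mem_iff i).2 hi)
      rw [root_reflectionPerm_self, map_neg, LinearMap.neg_apply] at hz
      exact ⟨-z, by rw [Int.cast_neg, ← hz, neg_neg]⟩
  exact (h.flip.card_filter_height_le (P := P.flip) hm (μ := P.halfSumCoroot pos) hint' hpos).trans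
    (h.card_filter_height_le hm hμ hμ0)

end RootPairing

namespace RootSystemData

open Module

variable {V : Type*} [AddCommGroup V] [Module ℚ V] (R : RootSystemData V)

lemma injOn_coroot : Set.InjOn R.coroot R.Φ := by
  intro α hα β hβ hαβ
  have hα2 := R.coroot_self α hα
  have hβ2 := R.coroot_self β hβ
  by_contra hne
  have hmem (n : ℕ) : β + (2 * n : ℚ) • (β - α) ∈ R.Φ := by
    induction n with
    | zero => simpa using hβ
    | succ n ih =>
      have h1 := R.reflect_mem β hβ _ (R.reflect_mem α hα _ ih)
      rw [hαβ] at h1 hα2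
      convert h1 using 1
      simp only [map_add, map_sub, map_smul, hα2, hβ2, smul_eq_mul]
      push_cast
      module
  refine Set.infinite_of_injective_forall_mem (f := fun n : ℕ ↦ β + (2 * n : ℚ) • (β - α)) ?_ hmem
    R.Φ.finite_toSet
  intro n n' hn
  have := smul_left_injective ℚ (sub_ne_zero.2 (Ne.symm hne)) (add_left_cancel hn)
  simpa using this

lemma exists_int_coroot_eq (i j : R.Φ) : ∃ z : ℤ, z = R.coroot j i := by
  obtain ⟨z, hz⟩ := R.crystallographic j j.2 i i.2
  exact ⟨z, hz.symm⟩

open scoped Classical in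
/-- The positive roots of a root system, as a set of roots. -/
noncomputable def posIndices : Finset R.Φ :=
  R.Pos.subtype (· ∈ R.Φ)

lemma mem_posIndices {i : R.Φ} : i ∈ R.posIndices ↔ (i : V) ∈ R.Pos := by
  classical
  exact Finset.mem_subtype

lemma card_filter_posIndices (p : V → Prop) [DecidablePred p] :
    (R.posIndices.filter fun i : R.Φ ↦ p i).card = (R.Pos.filter p).card := by
  rw [← Finset.card_map (Function.Embedding.subtype (· ∈ R.Φ))]
  congr 1
  ext α
  simp only [Finset.mem_map, Finset.mem_filter, mem_posIndices, Function.Embedding.subtype_apply]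
  constructor
  · rintro ⟨i, hi, rfl⟩
    exact hi
  · intro h
    exact ⟨⟨α, R.pos_subset h.1⟩, h, rfl⟩

variable [FiniteDimensional ℚ V]

/-- The root pairing between a rational vector space and its dual attached to a root system. -/
noncomputable def toRootPairing : RootPairing R.Φ ℚ V (Dual ℚ V) :=
  .mk'' (Dual.eval ℚ V) (Function.Embedding.subtype _)
    ⟨fun i ↦ R.coroot i, fun i j h ↦ Subtype.ext (R.injOn_coroot i.2 j.2 h)⟩
    (fun i ↦ R.coroot_self i i.2)
    (by
      rintro i _ ⟨j, rfl⟩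
      exact ⟨⟨_, R.reflect_mem i i.2 j j.2⟩, rfl⟩)
    (by simpa using R.span_eq_top)

@[simp]
lemma toRootPairing_root (i : R.Φ) : R.toRootPairing.root i = i := rfl

instance : R.toRootPairing.IsCrystallographic := ⟨R.exists_int_coroot_eq⟩

instance : R.toRootPairing.IsRootSystem :=
  RootPairing.isRootSystem_mk'' R.exists_int_coroot_eq

instance : R.toRootPairing.IsReduced where
  eq_or_eq_neg i j h := by
    rw [LinearIndependent.pair_iff' (R.toRootPairing.ne_zero i)] at h
    push Not at h
    obtain ⟨c, hc⟩ := h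
    simp only [toRootPairing_root] at hc ⊢
    rcases R.reduced i i.2 c (hc ▸ j.2) with rfl | rfl
    · left
      simpa using hc
    · right
      simp [← hc]

lemma isPositiveSystem : R.toRootPairing.IsPositiveSystem R.posIndices where
  reflectionPerm_self_mem_iff i := by
    have h := R.toRootPairing.root_reflectionPerm_self i
    simp only [toRootPairing_root] at h
    rw [mem_posIndices, mem_posIndices, h, R.pos_iff i i.2, not_not]
  add_mem i hi j hj k hk := by
    simp only [toRootPairing_root, mem_posIndices] at *
    rw [hk]
    exact R.pos_add i hi j hj (hk ▸ k.2)

lemma flip_halfSumCoroot :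
    R.toRootPairing.flip.halfSumCoroot R.posIndices = (2⁻¹ : ℚ) • ∑ α ∈ R.Pos, α := by
  classical
  exact congrArg _ (Finset.sum_subtype_of_mem id R.pos_subset)

lemma coroot_halfSum_pos {α : V} (hα : α ∈ R.Pos) :
    0 < R.coroot α ((2⁻¹ : ℚ) • ∑ β ∈ R.Pos, β) := by
  have h := R.isPositiveSystem.sum_pairing_pos (i := ⟨α, R.pos_subset hα⟩)
    (R.mem_posIndices.2 hα)
  have h2 := R.toRootPairing.flip.toLinearMap_root_halfSumCoroot R.posIndices
    ⟨α, R.pos_subset hα⟩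
  rw [flip_halfSumCoroot] at h2
  exact (mul_pos (by norm_num) h).trans_eq h2.symm

lemma coroot_neg {α : V} (hα : α ∈ R.Φ) : R.coroot (-α) = -R.coroot α := by
  have h := R.toRootPairing.root_reflectionPerm_self ⟨α, hα⟩
  rw [toRootPairing_root, toRootPairing_root] at h
  rw [← h]
  exact R.toRootPairing.flip.root_reflectionPerm_self ⟨α, hα⟩

end RootSystemData

/-- if `ρ` is the half-sum of the positive roots, `m > 0` and `λ` is a dominant
integral weight (all `⟨λ, α∨⟩` are nonnegative integers), then
`#{α ∈ Φ⁺ : m ∣ ⟨ρ, α∨⟩} ≤ #{α ∈ Φ⁺ : m ∣ ⟨λ+ρ, α∨⟩}`,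
where `Nρ` and `Nlam` are the integer-valued functions recording the (integral) pairings
`⟨ρ, α∨⟩` and `⟨λ+ρ, α∨⟩`. -/
theorem card_div_pairing_rho_le_card_div_pairing_add
    {V : Type*} [AddCommGroup V] [Module ℚ V] [FiniteDimensional ℚ V]
    (R : RootSystemData V) (m : ℕ) (hm : 0 < m)
    (ρ lam : V)
    (hρ : ρ = (2 : ℚ)⁻¹ • ∑ α ∈ R.Pos, α)
    (hdom : ∀ α ∈ R.Pos, ∃ k : ℕ, R.coroot α lam = (k : ℚ))
    (Nρ Nlam : V → ℤ)
    (hNρ : ∀ α ∈ R.Pos, (Nρ α : ℚ) = R.coroot α ρ)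
    (hNlam : ∀ α ∈ R.Pos, (Nlam α : ℚ) = R.coroot α (lam + ρ)) :
    (R.Pos.filter fun α => (m : ℤ) ∣ Nρ α).card ≤
      (R.Pos.filter fun α => (m : ℤ) ∣ Nlam α).card := by
  classical
  have hpos (α : V) (hα : α ∈ R.Pos) : R.coroot α (lam + ρ) ≠ 0 := by
    obtain ⟨k, hk⟩ := hdom α hα
    have := R.coroot_halfSum_pos hα
    rw [map_add, hk, hρ]
    positivity
  have hint (i : R.Φ) : ∃ z : ℤ, R.coroot i (lam + ρ) = z := by
    by_cases hi : (i : V) ∈ R.Pos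
    · exact ⟨_, (hNlam i hi).symm⟩
    · rw [R.pos_iff i i.2, not_not] at hi
      refine ⟨-Nlam (-i), ?_⟩
      rw [Int.cast_neg, hNlam _ hi, R.coroot_neg i.2, LinearMap.neg_apply, neg_neg]
  have hdvd (x : V) (f : V → ℤ) (hf : ∀ α ∈ R.Pos, (f α : ℚ) = R.coroot α x) :
      (R.Pos.filter fun α ↦ (m : ℤ) ∣ f α) =
        R.Pos.filter fun α ↦ ∃ z : ℤ, R.coroot α x = m * z := by
    refine Finset.filter_congr fun α hα ↦ exists_congr fun z ↦ ?_
    rw [← hf α hα]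
    norm_cast
  rw [hdvd ρ Nρ hNρ, hdvd _ Nlam hNlam, ← R.card_filter_posIndices, ← R.card_filter_posIndices]
  have h := R.isPositiveSystem.card_filter_halfSum_le hm hint
    fun i hi ↦ hpos i (R.mem_posIndices.1 hi)
  rw [R.flip_halfSumCoroot, ← hρ] at h
  exact h
end

section
/- (Type C case of Proposition 5.1.) Realize the root system of type C_l (l ≥ 2) inside ℤ^l with positive roots ε_i − ε_j (1 ≤ i < j ≤ l), ε_i + ε_j (1 ≤ i < j ≤ l), and 2ε_i (1 ≤ i ≤ l), whose heights are respectively j − i, 2l − i − j + 1, and 2l − 2i + 1. Then for every positive integer m, every positive root whose height is divisible by m can be written as a sum, with nonnegative integer coefficients, of positive roots of height exactly m. -/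
/-- The standard basis vector `ε_t` (`1 ≤ t ≤ l`) of `ℤ^l`, with 1-based indexing. -/
def eps (l t : ℕ) : Fin l → ℤ := fun s => if (s : ℕ) + 1 = t then 1 else 0

/-- `v` is a positive root of height `h` in the root system of type `C_l` realized in `ℤ^l`:
the positive roots are `ε_i − ε_j` (`1 ≤ i < j ≤ l`) of height `j − i`,
`ε_i + ε_j` (`1 ≤ i < j ≤ l`) of height `2l − i − j + 1`, and
`2ε_i` (`1 ≤ i ≤ l`) of height `2l − 2i + 1`. -/
def IsPosRootHtC (l : ℕ) (v : Fin l → ℤ) (h : ℕ) : Prop :=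
  (∃ i j : ℕ, 1 ≤ i ∧ i < j ∧ j ≤ l ∧ v = eps l i - eps l j ∧ h = j - i) ∨
  (∃ i j : ℕ, 1 ≤ i ∧ i < j ∧ j ≤ l ∧ v = eps l i + eps l j ∧ h = 2 * l - i - j + 1) ∨
  (∃ i : ℕ, 1 ≤ i ∧ i ≤ l ∧ v = (2 : ℤ) • eps l i ∧ h = 2 * l - 2 * i + 1)

/-- The weights of the vector representation of type `C_l` in decreasing order:
`ε_1, …, ε_l, -ε_l, …, -ε_1`, indexed by `1, …, 2l`. -/
def vectorWeight (l p : ℕ) : Fin l → ℤ :=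
  if p ≤ l then eps l p else -eps l (2 * l + 1 - p)

/-- Differences of weights of the vector representation at distance `h` are positive roots
of height `h`. -/
theorem isPosRootHtC_vectorWeight_sub {l p h : ℕ} (hp : 1 ≤ p) (hh : 0 < h)
    (hph : p + h ≤ 2 * l) :
    IsPosRootHtC l (vectorWeight l p - vectorWeight l (p + h)) h := by
  unfold vectorWeight
  by_cases h₂ : p + h ≤ l
  · rw [if_pos (by omega), if_pos h₂]
    exact Or.inl ⟨p, p + h, hp, by omega, h₂, rfl, by omega⟩
  rw [if_neg h₂]
  by_cases h₁ : p ≤ l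
  · rw [if_pos h₁, sub_neg_eq_add]
    rcases lt_trichotomy p (2 * l + 1 - (p + h)) with hlt | heq | hgt
    · exact Or.inr (Or.inl ⟨p, _, hp, hlt, by omega, rfl, by omega⟩)
    · exact Or.inr (Or.inr ⟨p, hp, h₁, by rw [← heq, two_smul], by omega⟩)
    · exact Or.inr (Or.inl ⟨_, p, by omega, hgt, h₁, add_comm _ _, by omega⟩)
  · rw [if_neg h₁]
    exact Or.inl ⟨2 * l + 1 - (p + h), 2 * l + 1 - p, by omega, by omega, by omega,
      by abel, by omega⟩

/-- Every positive root of height `h` is a difference of weights of the vector representation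
at distance `h`. -/
theorem IsPosRootHtC.exists_vectorWeight_sub {l h : ℕ} {v : Fin l → ℤ}
    (hv : IsPosRootHtC l v h) :
    ∃ p, 1 ≤ p ∧ p + h ≤ 2 * l ∧ v = vectorWeight l p - vectorWeight l (p + h) := by
  unfold vectorWeight
  rcases hv with ⟨i, j, hi, hij, hj, rfl, rfl⟩ | ⟨i, j, hi, hij, hj, rfl, rfl⟩ |
    ⟨i, hi, hil, rfl, rfl⟩
  · refine ⟨i, hi, by omega, ?_⟩
    rw [if_pos (by omega), if_pos (by omega), Nat.add_sub_cancel' hij.le]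
  · refine ⟨i, hi, by omega, ?_⟩
    rw [if_pos (by omega), if_neg (by omega), sub_neg_eq_add,
      show 2 * l + 1 - (i + (2 * l - i - j + 1)) = j by omega]
  · refine ⟨i, hi, by omega, ?_⟩
    rw [if_pos hil, if_neg (by omega), sub_neg_eq_add,
      show 2 * l + 1 - (i + (2 * l - 2 * i + 1)) = i by omega, two_smul]

theorem vectorWeight_sub_mem_closure {l m p : ℕ} (hm : 0 < m) (hp : 1 ≤ p) (k : ℕ)
    (hpk : p + m * k ≤ 2 * l) :
    vectorWeight l p - vectorWeight l (p + m * k) ∈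
      AddSubmonoid.closure {w : Fin l → ℤ | IsPosRootHtC l w m} := by
  induction k with
  | zero => simp
  | succ k ih =>
    rw [Nat.mul_succ, ← add_assoc] at hpk ⊢
    rw [← sub_add_sub_cancel _ (vectorWeight l (p + m * k))]
    exact add_mem (ih (by omega)) (AddSubmonoid.subset_closure
      (isPosRootHtC_vectorWeight_sub (by omega) hm hpk))

/-- type `C_l` case of Proposition 5.1: for `l ≥ 2` and any positive integer
`m`, every positive root of type `C_l` whose height is divisible by `m` is a sum, with
nonnegative integer coefficients, of positive roots of height exactly `m`. -/
theorem typeC_height_divisible_sum (l m : ℕ) (hl : 2 ≤ l) (hm : 0 < m)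
    (v : Fin l → ℤ) (h : ℕ) (hv : IsPosRootHtC l v h) (hdvd : m ∣ h) :
    v ∈ AddSubmonoid.closure {w : Fin l → ℤ | IsPosRootHtC l w m} := by
  obtain ⟨k, rfl⟩ := hdvd
  obtain ⟨p, hp, hpk, rfl⟩ := hv.exists_vectorWeight_sub
  exact vectorWeight_sub_mem_closure hm hp k hpk
end

section
/- (Type B case of Proposition 5.1.) Realize the root system of type B_l (l ≥ 2) inside ℤ^l with positive roots ε_i − ε_j (1 ≤ i < j ≤ l), ε_i + ε_j (1 ≤ i < j ≤ l), and ε_i (1 ≤ i ≤ l), whose heights are respectively j − i, 2l − i − j + 2, and l − i + 1. Then for every ODD positive integer m, every positive root whose height is divisible by m can be written as a sum, with nonnegative integer coefficients, of positive roots of height exactly m. -/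
/-- `v` is a positive root of height `h` in the root system of type `B_l` realized in `ℤ^l`:
the positive roots are `ε_i − ε_j` (`1 ≤ i < j ≤ l`) of height `j − i`,
`ε_i + ε_j` (`1 ≤ i < j ≤ l`) of height `2l − i − j + 2`, and
`ε_i` (`1 ≤ i ≤ l`) of height `l − i + 1`. -/
def IsPosRootHtB (l : ℕ) (v : Fin l → ℤ) (h : ℕ) : Prop :=
  (∃ i j : ℕ, 1 ≤ i ∧ i < j ∧ j ≤ l ∧ v = eps l i - eps l j ∧ h = j - i) ∨
  (∃ i j : ℕ, 1 ≤ i ∧ i < j ∧ j ≤ l ∧ v = eps l i + eps l j ∧ h = 2 * l - i - j + 2) ∨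
  (∃ i : ℕ, 1 ≤ i ∧ i ≤ l ∧ v = eps l i ∧ h = l - i + 1)

theorem eps_eq_zero_of_lt {l t : ℕ} (h : l < t) : eps l t = 0 := by
  funext s
  have := s.isLt
  simp only [eps, Pi.zero_apply]
  rw [if_neg (by omega)]

/-- The vector of signed height `x`: it is `ε_{l+1-x}` for `1 ≤ x ≤ l`, zero for `x = 0`, and
`-ε_{l+1+x}` for `-l ≤ x ≤ -1`. -/
def signedEps (l : ℕ) (x : ℤ) : Fin l → ℤ :=
  eps l (l + 1 - x).toNat - eps l (l + 1 + x).toNat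

theorem signedEps_neg (l : ℕ) (x : ℤ) : signedEps l (-x) = -signedEps l x := by
  simp [signedEps, sub_eq_add_neg]

theorem signedEps_zero (l : ℕ) : signedEps l 0 = 0 := by
  simp [signedEps]

theorem signedEps_of_add_eq {l i : ℕ} {x : ℤ} (hx : 0 < x) (h : x + i = l + 1) :
    signedEps l x = eps l i := by
  rw [signedEps, eps_eq_zero_of_lt (t := (l + 1 + x).toNat) (by omega), sub_zero]
  congr 1
  omega

theorem signedEps_of_sub_eq {l i : ℕ} {x : ℤ} (hx : x < 0) (h : i - x = l + 1) :
    signedEps l x = -eps l i := by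
  rw [← neg_neg x, signedEps_neg, signedEps_of_add_eq (i := i) (by omega) (by omega)]

/-- A difference of signed basis vectors is a positive root, unless it is twice a basis vector. -/
theorem isPosRootHtB_signedEps_sub {l m : ℕ} {x y : ℤ} (hm : 0 < m) (hxy : x - y = m)
    (hy : -(l : ℤ) ≤ y) (hx : x ≤ l) (hne : x + y ≠ 0) :
    IsPosRootHtB l (signedEps l x - signedEps l y) m := by
  have pos (z : ℤ) (h0 : 0 < z) (hz : z ≤ l) :
      ∃ i : ℕ, z + i = l + 1 ∧ signedEps l z = eps l i :=
    ⟨(l + 1 - z).toNat, by omega, signedEps_of_add_eq h0 (by omega)⟩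
  have neg (z : ℤ) (h0 : z < 0) (hz : -(l : ℤ) ≤ z) :
      ∃ i : ℕ, i - z = l + 1 ∧ signedEps l z = -eps l i :=
    ⟨(l + 1 + z).toNat, by omega, signedEps_of_sub_eq h0 (by omega)⟩
  rcases lt_trichotomy x 0 with hx0 | rfl | hx0
  · obtain ⟨i, hi, ei⟩ := neg x hx0 (by omega)
    obtain ⟨j, hj, ej⟩ := neg y (by omega) hy
    exact Or.inl ⟨j, i, by omega, by omega, by omega, by rw [ei, ej]; abel, by omega⟩
  · obtain ⟨j, hj, ej⟩ := neg y (by omega) hy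
    exact Or.inr <| Or.inr ⟨j, by omega, by omega, by rw [signedEps_zero, ej]; abel, by omega⟩
  · obtain ⟨i, hi, ei⟩ := pos x hx0 hx
    rcases lt_trichotomy y 0 with hy0 | rfl | hy0
    · obtain ⟨j, hj, ej⟩ := neg y hy0 hy
      rcases lt_or_gt_of_ne (show i ≠ j by omega) with hij | hij
      · exact Or.inr <| Or.inl
          ⟨i, j, by omega, hij, by omega, by rw [ei, ej]; abel, by omega⟩
      · exact Or.inr <| Or.inl
          ⟨j, i, by omega, hij, by omega, by rw [ei, ej]; abel, by omega⟩
    · exact Or.inr <| Or.inr ⟨i, by omega, by omega, by rw [signedEps_zero, ei]; abel, by omega⟩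
    · obtain ⟨j, hj, ej⟩ := pos y hy0 (by omega)
      exact Or.inl ⟨i, j, by omega, by omega, by omega, by rw [ei, ej], by omega⟩

theorem IsPosRootHtB.exists_signedEps_sub {l h : ℕ} {v : Fin l → ℤ} (hv : IsPosRootHtB l v h) :
    ∃ x y : ℤ, x - y = h ∧ -(l : ℤ) ≤ y ∧ x ≤ l ∧ v = signedEps l x - signedEps l y := by
  rcases hv with ⟨i, j, hi, hij, hj, rfl, rfl⟩ | ⟨i, j, hi, hij, hj, rfl, rfl⟩ |
    ⟨i, hi, hil, rfl, rfl⟩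
  · refine ⟨l + 1 - i, l + 1 - j, by omega, by omega, by omega, ?_⟩
    rw [signedEps_of_add_eq (i := i) (by omega) (by omega),
      signedEps_of_add_eq (i := j) (by omega) (by omega)]
  · refine ⟨l + 1 - i, j - (l + 1), by omega, by omega, by omega, ?_⟩
    rw [signedEps_of_add_eq (i := i) (by omega) (by omega),
      signedEps_of_sub_eq (i := j) (by omega) (by omega), sub_neg_eq_add]
  · refine ⟨l + 1 - i, 0, by omega, by omega, by omega, ?_⟩
    rw [signedEps_of_add_eq (i := i) (by omega) (by omega), signedEps_zero, sub_zero]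

theorem signedEps_sub_mem_closure {l m : ℕ} (hm : 0 < m) (hodd : Odd m) {y : ℤ}
    (hy : -(l : ℤ) ≤ y) (k : ℕ) (hk : y + m * k ≤ l) :
    signedEps l (y + m * k) - signedEps l y ∈
      AddSubmonoid.closure {w : Fin l → ℤ | IsPosRootHtB l w m} := by
  induction k with
  | zero => simp
  | succ k ih =>
    have hmk : (0 : ℤ) ≤ m * k := by positivity
    push_cast [mul_add, mul_one] at hk ⊢
    rw [← sub_add_sub_cancel _ (signedEps l (y + m * k))]
    refine add_mem (AddSubmonoid.subset_closure ?_) (ih (by omega))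
    obtain ⟨n, rfl⟩ := hodd
    exact isPosRootHtB_signedEps_sub hm (by ring) (by omega) hk (by omega)

/-- type `B_l` case of Proposition 5.1: for `l ≥ 2` and any ODD positive
integer `m`, every positive root of type `B_l` whose height is divisible by `m` is a sum,
with nonnegative integer coefficients, of positive roots of height exactly `m`. -/
theorem typeB_height_divisible_sum (l m : ℕ) (hl : 2 ≤ l) (hm : 0 < m) (hodd : Odd m)
    (v : Fin l → ℤ) (h : ℕ) (hv : IsPosRootHtB l v h) (hdvd : m ∣ h) :
    v ∈ AddSubmonoid.closure {w : Fin l → ℤ | IsPosRootHtB l w m} := by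
  obtain ⟨x, y, hxy, hy, hx, rfl⟩ := hv.exists_signedEps_sub
  obtain ⟨k, rfl⟩ := hdvd
  obtain rfl : x = y + m * k := by push_cast at hxy; omega
  exact signedEps_sub_mem_closure hm hodd hy k hx
end

section
/- Let n, d, a be positive integers with n = d·a, and let x be an invertible n×n complex matrix with x^d = 1. Then the ℂ-dimension of the commutant {Y ∈ M_n(ℂ) : xY = Yx} is at least d·a² = n²/d, with equality if and only if the characteristic polynomial of x equals (T^d − 1)^a, i.e. every d-th root of unity is an eigenvalue of x with multiplicity exactly a (so x is conjugate to the principal element C_d of order d). -/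
open Polynomial

/-- The commutant of `x` in `M_n(ℂ)`: the subspace of matrices commuting with `x`,
realized as the kernel of `Y ↦ xY − Yx`. -/
noncomputable def commutant {n : ℕ} (x : Matrix (Fin n) (Fin n) ℂ) :
    Submodule ℂ (Matrix (Fin n) (Fin n) ℂ) :=
  LinearMap.ker (LinearMap.mulLeft ℂ x - LinearMap.mulRight ℂ x)

theorem mem_commutant {n : ℕ} {x Y : Matrix (Fin n) (Fin n) ℂ} :
    Y ∈ commutant x ↔ x * Y = Y * x := by
  simp [commutant, sub_eq_zero]

/-- An endomorphism whose eigenspaces span has a basis of eigenvectors. -/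
theorem exists_basis_apply_eq_smul {K V : Type*} [Field K] [AddCommGroup V] [Module K V]
    [FiniteDimensional K V] {n : ℕ} (hn : Module.finrank K V = n) (f : Module.End K V)
    (hf : ⨆ μ, f.eigenspace μ = ⊤) :
    ∃ (b : Module.Basis (Fin n) K V) (v : Fin n → K), ∀ i, f (b i) = v i • b i := by
  have hs : ⊤ ≤ Submodule.span K {w : V | ∃ μ : K, f w = μ • w} := by
    rw [← hf]
    refine iSup_le fun μ w hw => Submodule.subset_span ⟨μ, ?_⟩
    exact Module.End.mem_eigenspace_iff.mp hw
  let b₀ := Module.Basis.ofSpan hs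
  have hb₀ : ∀ i, ∃ μ : K, f (b₀ i) = μ • b₀ i := fun i =>
    Module.Basis.ofSpan_subset hs ⟨i, rfl⟩
  have : Fintype _ := FiniteDimensional.fintypeBasisIndex b₀
  let e := Fintype.equivFinOfCardEq ((Module.finrank_eq_card_basis b₀).symm.trans hn)
  choose v hv using hb₀
  exact ⟨b₀.reindex e, fun i => v (e.symm i), fun i => by simp [hv]⟩

/-- A complex matrix of finite order is diagonalizable, by an algebra automorphism of `M_n(ℂ)`
preserving characteristic polynomials, with roots of unity on the diagonal. -/
theorem exists_algEquiv_diagonal {n d : ℕ} (hd : 0 < d) (x : Matrix (Fin n) (Fin n) ℂ)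
    (hx : x ^ d = 1) :
    ∃ (e : Matrix (Fin n) (Fin n) ℂ ≃ₐ[ℂ] Matrix (Fin n) (Fin n) ℂ) (v : Fin n → ℂ),
      e x = Matrix.diagonal v ∧ (e x).charpoly = x.charpoly ∧ ∀ i, v i ^ d = 1 := by
  have hfd : x.toLin' ^ d = 1 := by
    rw [← Matrix.toLin'_pow, hx, Matrix.toLin'_one]; rfl
  have hss : Module.End.IsSemisimple x.toLin' := by
    refine Module.End.isSemisimple_of_squarefree_aeval_eq_zero (p := X ^ d - 1) ?_ ?_
    · exact (Polynomial.separable_X_pow_sub_C (1 : ℂ) (by exact_mod_cast hd.ne')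
        one_ne_zero).squarefree
    · simp [hfd]
  obtain ⟨b, v, hb⟩ := exists_basis_apply_eq_smul (n := n) (by simp) x.toLin'
    hss.iSup_eigenspace_eq_top
  have hex : LinearMap.toMatrix b b x.toLin' = Matrix.diagonal v := by
    ext i j
    rw [LinearMap.toMatrix_apply, hb]
    by_cases h : i = j
    · simp [h]
    · simp [h]
  let e := Matrix.toLinAlgEquiv'.trans (LinearMap.toMatrixAlgEquiv b)
  have he : e x = Matrix.diagonal v := hex
  refine ⟨e, v, he, ?_, fun i => ?_⟩
  · rw [he, ← hex, LinearMap.charpoly_toMatrix, Matrix.charpoly_toLin']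
  · have h : Matrix.diagonal v ^ d = 1 := by rw [← he, ← map_pow, hx, map_one]
    rw [Matrix.diagonal_pow] at h
    simpa using congrFun (congrFun h i) i

theorem finrank_commutant_algEquiv {n : ℕ}
    (e : Matrix (Fin n) (Fin n) ℂ ≃ₐ[ℂ] Matrix (Fin n) (Fin n) ℂ)
    (x : Matrix (Fin n) (Fin n) ℂ) :
    Module.finrank ℂ (commutant (e x)) = Module.finrank ℂ (commutant x) := by
  have h : commutant (e x) = (commutant x).map e.toLinearEquiv.toLinearMap := by
    ext Y
    obtain ⟨Z, rfl⟩ := e.surjective Y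
    rw [mem_commutant, ← map_mul, ← map_mul, e.injective.eq_iff, ← mem_commutant]
    simp
  rw [h]
  exact LinearEquiv.finrank_map_eq e.toLinearEquiv _

open Classical in
/-- The commutant of a diagonal matrix consists of the matrices supported on pairs of indices
with equal diagonal entries. -/
noncomputable def commutantDiagonalEquiv {n : ℕ} (v : Fin n → ℂ) :
    commutant (Matrix.diagonal v) ≃ₗ[ℂ] ({p : Fin n × Fin n // v p.1 = v p.2} → ℂ) where
  toFun Y p := Y.1 p.1.1 p.1.2
  map_add' _ _ := rfl
  map_smul' _ _ := rfl
  invFun g := ⟨Matrix.of fun i j => if h : v i = v j then g ⟨(i, j), h⟩ else 0, by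
    rw [mem_commutant]
    ext i j
    rw [Matrix.diagonal_mul, Matrix.mul_diagonal, Matrix.of_apply]
    split_ifs with h
    · rw [h, mul_comm]
    · simp⟩
  left_inv Y := by
    ext i j
    have h := congrFun (congrFun (mem_commutant.mp Y.2) i) j
    rw [Matrix.diagonal_mul, Matrix.mul_diagonal, mul_comm] at h
    simp only [Matrix.of_apply]
    split_ifs with hij
    · rfl
    · by_contra h0
      exact hij (mul_left_cancel₀ (Ne.symm h0) h)
  right_inv g := by
    ext ⟨p, hp⟩
    simp [hp]

theorem finrank_commutant_diagonal {n : ℕ} (v : Fin n → ℂ) (S : Finset ℂ) (hS : ∀ i, v i ∈ S) :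
    Module.finrank ℂ (commutant (Matrix.diagonal v)) =
      ∑ z ∈ S, (Finset.univ.filter fun i => v i = z).card ^ 2 := by
  classical
  rw [(commutantDiagonalEquiv v).finrank_eq, Module.finrank_fintype_fun_eq_card,
    Fintype.card_subtype,
    Finset.card_eq_sum_card_fiberwise (f := fun p : Fin n × Fin n => v p.1) (t := S)
      fun p _ => hS p.1]
  refine Finset.sum_congr rfl fun z _ => ?_
  rw [sq, ← Finset.card_product]
  congr 1
  ext p
  simp only [Finset.mem_filter, Finset.mem_univ, true_and, Finset.mem_product]
  constructor
  · rintro ⟨h, h'⟩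
    exact ⟨h', h ▸ h'⟩
  · rintro ⟨h, h'⟩
    exact ⟨h.trans h'.symm, h⟩

theorem charpoly_diagonal_eq_pow_iff {n : ℕ} (v : Fin n → ℂ) (S : Finset ℂ) (a : ℕ)
    (hS : ∀ i, v i ∈ S) :
    (Matrix.diagonal v).charpoly = (∏ z ∈ S, (X - C z)) ^ a ↔
      ∀ z ∈ S, (Finset.univ.filter fun i => v i = z).card = a := by
  classical
  have hprod : (Matrix.diagonal v).charpoly =
      ∏ z ∈ S, (X - C z) ^ (Finset.univ.filter fun i => v i = z).card := by
    rw [Matrix.charpoly_diagonal, ← Finset.prod_fiberwise_of_maps_to (g := v) fun i _ => hS i]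
    refine Finset.prod_congr rfl fun z _ => ?_
    rw [Finset.prod_congr rfl fun i hi => by rw [(Finset.mem_filter.mp hi).2], Finset.prod_const]
  constructor
  · intro h z hz
    have hr := congrArg (fun p => p.roots.count z) h
    simp only [Matrix.charpoly_diagonal, Polynomial.roots_pow, Multiset.count_nsmul,
      Polynomial.roots_prod_X_sub_C] at hr
    rw [Multiset.count_eq_one_of_mem S.nodup hz, mul_one] at hr
    rw [← hr, Polynomial.roots_prod _ _ (Finset.prod_ne_zero_iff.mpr fun i _ => X_sub_C_ne_zero _)]
    simp only [roots_X_sub_C, Multiset.bind_singleton, Multiset.count_map, Finset.card_def,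
      Finset.filter_val, eq_comm (a := z)]
  · intro h
    rw [hprod, ← Finset.prod_pow]
    exact Finset.prod_congr rfl fun z hz => by rw [h z hz]

/-- Natural numbers `m z` with mean `a` have sum of squares at least `#S * a ^ 2`, with equality
exactly when they are all equal to `a`. -/
theorem card_mul_sq_le_sum_sq_and_eq_iff {ι : Type*} (S : Finset ι) (m : ι → ℕ) (a : ℕ)
    (hm : ∑ z ∈ S, m z = S.card * a) :
    S.card * a ^ 2 ≤ ∑ z ∈ S, m z ^ 2 ∧
      (∑ z ∈ S, m z ^ 2 = S.card * a ^ 2 ↔ ∀ z ∈ S, m z = a) := by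
  have key : ∑ z ∈ S, ((m z : ℤ) - a) ^ 2 = ∑ z ∈ S, (m z : ℤ) ^ 2 - S.card * a ^ 2 := by
    have hm' : ∑ z ∈ S, (m z : ℤ) = S.card * a := by exact_mod_cast hm
    simp only [sub_sq, Finset.sum_add_distrib, Finset.sum_sub_distrib, ← Finset.sum_mul,
      ← Finset.mul_sum, hm', Finset.sum_const, nsmul_eq_mul]
    ring
  have hnn : ∀ z ∈ S, 0 ≤ ((m z : ℤ) - a) ^ 2 := fun z _ => sq_nonneg _
  constructor
  · have := Finset.sum_nonneg hnn
    zify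
    linarith
  · have h0 := Finset.sum_eq_zero_iff_of_nonneg hnn
    rw [key, sub_eq_zero] at h0
    have h1 : (∀ z ∈ S, ((m z : ℤ) - a) ^ 2 = 0) ↔ ∀ z ∈ S, m z = a := by
      simp [sub_eq_zero]
    rw [← h1, ← h0]
    exact_mod_cast Iff.rfl

/-- if `n = d·a` with `d, a ≥ 1` and `x ∈ GL_n(ℂ)` satisfies `x^d = 1`, then
`dim_ℂ {Y : xY = Yx} ≥ d·a²`, with equality iff the characteristic polynomial of `x` is
`(T^d − 1)^a` (i.e. `x` is conjugate to the principal element `C_d` of order `d`). -/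
theorem commutant_dim_ge_of_pow_eq_one {n d a : ℕ} (hd : 0 < d) (ha : 0 < a)
    (hn : n = d * a) (x : Matrix (Fin n) (Fin n) ℂ)
    (hxu : IsUnit x) (hx : x ^ d = 1) :
    d * a ^ 2 ≤ Module.finrank ℂ (commutant x) ∧
    (Module.finrank ℂ (commutant x) = d * a ^ 2 ↔
      x.charpoly = ((X : ℂ[X]) ^ d - 1) ^ a) := by
  obtain ⟨e, v, hev, hchar, hv⟩ := exists_algEquiv_diagonal hd x hx
  have hζ := Complex.isPrimitiveRoot_exp d hd.ne'
  have hS : ∀ i, v i ∈ nthRootsFinset d (1 : ℂ) := fun i => (mem_nthRootsFinset hd 1).mpr (hv i)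
  have hsum : ∑ z ∈ nthRootsFinset d (1 : ℂ), (Finset.univ.filter fun i => v i = z).card =
      (nthRootsFinset d (1 : ℂ)).card * a := by
    rw [← Finset.card_eq_sum_card_fiberwise fun i _ => hS i, hζ.card_nthRootsFinset,
      Finset.card_univ, Fintype.card_fin, hn]
  rw [← finrank_commutant_algEquiv e, ← hchar, hev, X_pow_sub_one_eq_prod hd hζ,
    finrank_commutant_diagonal v _ hS, charpoly_diagonal_eq_pow_iff v _ a hS]
  simpa only [hζ.card_nthRootsFinset] using card_mul_sq_le_sum_sq_and_eq_iff _ _ a hsum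
end

section
/- Let n, d be positive integers and write n = d·a + b with 0 ≤ b < d. Let x be an invertible n×n complex matrix with x^d = 1. Then the ℂ-dimension of the commutant {Y ∈ M_n(ℂ) : xY = Yx} is at least (d − b)·a² + b·(a+1)², with equality if and only if exactly b of the d d-th roots of unity occur as eigenvalues of x with multiplicity a + 1 and the remaining d − b occur with multiplicity a. -/
open Polynomial

/-- The multiplicity of `μ` as an eigenvalue of the matrix `x` (0 if not an eigenvalue):
the dimension of the `μ`-eigenspace. -/
noncomputable def eigMult {n : ℕ} (x : Matrix (Fin n) (Fin n) ℂ) (μ : ℂ) : ℕ :=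
  Module.finrank ℂ (Module.End.eigenspace (Matrix.toLin' x) μ)

/-- A sum of `m i ^ 2` expanded around the consecutive integers `a` and `a + 1`. -/
lemma sum_sq_eq_add_sum_mul {ι : Type*} (s : Finset ι) (m : ι → ℕ) {a b : ℕ} (hb : b ≤ s.card)
    (hm : ∑ i ∈ s, m i = s.card * a + b) :
    ((∑ i ∈ s, m i ^ 2 : ℕ) : ℤ) = (((s.card - b) * a ^ 2 + b * (a + 1) ^ 2 : ℕ) : ℤ) +
      ∑ i ∈ s, ((m i : ℤ) - a) * ((m i : ℤ) - (a + 1)) := by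
  have h : ∑ i ∈ s, ((m i : ℤ) - a) * ((m i : ℤ) - (a + 1)) =
      ∑ i ∈ s, (m i : ℤ) ^ 2 - (2 * a + 1) * ∑ i ∈ s, (m i : ℤ) + s.card * (a * (a + 1)) := by
    rw [Finset.mul_sum, ← Finset.sum_sub_distrib, ← nsmul_eq_mul, ← Finset.sum_const,
      ← Finset.sum_add_distrib]
    exact Finset.sum_congr rfl fun i _ ↦ by ring
  have hm' : ∑ i ∈ s, (m i : ℤ) = s.card * a + b := by exact_mod_cast hm
  rw [h, hm']
  push_cast [hb]
  ring

lemma sub_mul_sub_add_one_nonneg (m a : ℕ) : 0 ≤ ((m : ℤ) - a) * ((m : ℤ) - (a + 1)) := by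
  rcases le_or_gt m a with h | h
  · exact mul_nonneg_of_nonpos_of_nonpos (by lia) (by lia)
  · exact mul_nonneg (by lia) (by lia)

lemma le_sum_sq_of_sum_eq {ι : Type*} (s : Finset ι) (m : ι → ℕ) {a b : ℕ} (hb : b ≤ s.card)
    (hm : ∑ i ∈ s, m i = s.card * a + b) :
    (s.card - b) * a ^ 2 + b * (a + 1) ^ 2 ≤ ∑ i ∈ s, m i ^ 2 := by
  have h := sum_sq_eq_add_sum_mul s m hb hm
  have h0 := Finset.sum_nonneg fun i (_ : i ∈ s) ↦ sub_mul_sub_add_one_nonneg (m i) a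
  lia

lemma sum_sq_eq_iff_of_sum_eq {ι : Type*} (s : Finset ι) (m : ι → ℕ) {a b : ℕ}
    (hb : b ≤ s.card) (hm : ∑ i ∈ s, m i = s.card * a + b) :
    ∑ i ∈ s, m i ^ 2 = (s.card - b) * a ^ 2 + b * (a + 1) ^ 2 ↔
      ∀ i ∈ s, m i = a ∨ m i = a + 1 := by
  have h := sum_sq_eq_add_sum_mul s m hb hm
  have h0 := Finset.sum_eq_zero_iff_of_nonneg
    fun i (_ : i ∈ s) ↦ sub_mul_sub_add_one_nonneg (m i) a
  rw [← Int.natCast_inj, h, add_eq_left, h0]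
  refine forall₂_congr fun i _ ↦ ?_
  rw [mul_eq_zero]
  lia

open Classical in
lemma forall_eq_or_eq_add_one_iff_exists_card_eq {ι : Type*} (s : Finset ι) (m : ι → ℕ) {a b : ℕ}
    (hm : ∑ i ∈ s, m i = s.card * a + b) :
    (∀ i ∈ s, m i = a ∨ m i = a + 1) ↔
      ∃ t : Finset ι, t.card = b ∧ t ⊆ s ∧ ∀ i ∈ s, m i = if i ∈ t then a + 1 else a := by
  constructor
  · intro h
    have hif : ∀ i ∈ s, m i = a + if m i = a + 1 then 1 else 0 := by
      intro i hi
      rcases h i hi with h | h <;> simp [h]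
    refine ⟨s.filter fun i ↦ m i = a + 1, ?_, Finset.filter_subset _ _, fun i hi ↦ ?_⟩
    · rw [Finset.sum_congr rfl hif, Finset.sum_add_distrib, Finset.sum_const, smul_eq_mul] at hm
      rw [Finset.card_filter]
      lia
    · rcases h i hi with h | h <;> simp [h, hi]
  · rintro ⟨t, -, -, h⟩ i hi
    rw [h i hi]
    split_ifs <;> simp

section Eigenspaces

variable {K V : Type*} [Field K] [AddCommGroup V] [Module K V]

open Module Module.End

lemma Module.End.mapsTo_eigenspace_of_commute {f g : End K V} (h : Commute f g) (μ : K) :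
    ∀ v ∈ f.eigenspace μ, g v ∈ f.eigenspace μ := by
  intro v hv
  rw [mem_eigenspace_iff] at hv ⊢
  rw [← Module.End.mul_apply, h.eq, Module.End.mul_apply, hv, map_smul]

/-- Restriction of an endomorphism commuting with `f` to the eigenspaces of `f`. -/
def Module.End.commutantToPiEigenspace (f : End K V) (s : Finset K) :
    LinearMap.ker (LinearMap.mulLeft K f - LinearMap.mulRight K f) →ₗ[K]
      ((z : s) → End K (f.eigenspace (z : K))) where
  toFun g z := g.1.restrict (mapsTo_eigenspace_of_commute
    (sub_eq_zero.1 (LinearMap.mem_ker.1 g.2) : f * g.1 = g.1 * f) z)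
  map_add' _ _ := rfl
  map_smul' _ _ := rfl

variable [DecidableEq K]

lemma Module.End.commutantToPiEigenspace_bijective (f : End K V) (s : Finset K)
    (hs : DirectSum.IsInternal fun z : s ↦ f.eigenspace (z : K)) :
    Function.Bijective (f.commutantToPiEigenspace s) := by
  have key {g h : End K V} (H : ∀ z : s, ∀ v ∈ f.eigenspace (z : K), g v = h v) : g = h := by
    refine LinearMap.ext fun v ↦ ?_
    have hv : v ∈ ⨆ z : s, f.eigenspace (z : K) := by
      rw [hs.submodule_iSup_eq_top]; trivial
    induction hv using Submodule.iSup_induction' with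
    | mem z v hv => exact H z v hv
    | zero => simp
    | add x y _ _ hx hy => rw [map_add, map_add, hx, hy]
  constructor
  · intro g h hgh
    refine Subtype.ext (key fun z v hv ↦ ?_)
    exact congrArg Subtype.val (LinearMap.congr_fun (congrFun hgh z) ⟨v, hv⟩)
  · intro h
    let e := LinearEquiv.ofBijective
      (DirectSum.coeLinearMap fun z : s ↦ f.eigenspace (z : K)) hs
    let g : End K V := (DirectSum.toModule K s V
      fun z ↦ (f.eigenspace (z : K)).subtype ∘ₗ h z) ∘ₗ e.symm.toLinearMap
    have hg (z : s) (v : f.eigenspace (z : K)) : g v = h z v := by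
      have he : e.symm (v : V) = DirectSum.lof K s (fun z : s ↦ f.eigenspace (z : K)) z v := by
        rw [LinearEquiv.symm_apply_eq]
        exact (DirectSum.coeLinearMap_lof (fun z : s ↦ f.eigenspace (z : K)) z v).symm
      simp [g, he]
    have hfg : f * g = g * f := by
      refine key fun z v hv ↦ ?_
      have hgv := hg z ⟨v, hv⟩
      rw [Module.End.mul_apply, Module.End.mul_apply, mem_eigenspace_iff.1 hv, map_smul, hgv]
      exact mem_eigenspace_iff.1 (h z ⟨v, hv⟩).2
    refine ⟨⟨g, by simp [hfg]⟩, ?_⟩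
    ext z v
    exact hg z v

lemma Module.End.finrank_commutant_eq_sum_sq [FiniteDimensional K V] (f : End K V) (s : Finset K)
    (hs : DirectSum.IsInternal fun z : s ↦ f.eigenspace (z : K)) :
    finrank K (LinearMap.ker (LinearMap.mulLeft K f - LinearMap.mulRight K f)) =
      ∑ z ∈ s, finrank K (f.eigenspace z) ^ 2 := by
  rw [(LinearEquiv.ofBijective _ (f.commutantToPiEigenspace_bijective s hs)).finrank_eq,
    finrank_pi_fintype, ← Finset.sum_coe_sort s]
  exact Finset.sum_congr rfl fun z _ ↦ by rw [finrank_linearMap, sq]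

lemma Module.End.finrank_eq_sum_finrank_eigenspace [FiniteDimensional K V] (f : End K V)
    (s : Finset K) (hs : DirectSum.IsInternal fun z : s ↦ f.eigenspace (z : K)) :
    finrank K V = ∑ z ∈ s, finrank K (f.eigenspace z) := by
  rw [← (LinearEquiv.ofBijective (DirectSum.coeLinearMap _) hs).finrank_eq, finrank_directSum,
    ← Finset.sum_coe_sort s]

lemma Module.End.isInternal_eigenspace_nthRoots_of_pow_eq_one [IsAlgClosed K] [CharZero K]
    [FiniteDimensional K V] {f : End K V} {d : ℕ} (hd : 0 < d) (hf : f ^ d = 1) :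
    DirectSum.IsInternal fun z : nthRootsFinset d (1 : K) ↦ f.eigenspace (z : K) := by
  have hss : f.IsFinitelySemisimple := by
    refine (isSemisimple_of_squarefree_aeval_eq_zero (p := X ^ d - C 1) ?_
      (by simp [hf])).isFinitelySemisimple
    exact (separable_X_pow_sub_C 1 (by exact_mod_cast hd.ne') one_ne_zero).squarefree
  rw [DirectSum.isInternal_submodule_iff_iSupIndep_and_iSup_eq_top]
  refine ⟨(eigenspaces_iSupIndep f).comp Subtype.val_injective, ?_⟩
  rw [eq_top_iff, ← iSup_maxGenEigenspace_eq_top f]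
  refine iSup_le fun z ↦ ?_
  rw [hss.maxGenEigenspace_eq_eigenspace]
  by_cases hz : z ∈ nthRootsFinset d (1 : K)
  · exact le_iSup (fun z : nthRootsFinset d (1 : K) ↦ f.eigenspace (z : K)) ⟨z, hz⟩
  · suffices f.eigenspace z = ⊥ by simp [this]
    by_contra hne
    obtain ⟨v, hv⟩ := HasEigenvalue.exists_hasEigenvector (f := f) (μ := z) hne
    have h := hv.pow_apply d
    rw [hf, Module.End.one_apply] at h
    refine hz ((mem_nthRootsFinset hd (1 : K)).2 ?_)
    exact (smul_left_injective K hv.2 (by simpa using h)).symm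

end Eigenspaces

lemma finrank_commutant_eq_finrank_commutant_toLin' {n : ℕ} (x : Matrix (Fin n) (Fin n) ℂ) :
    Module.finrank ℂ (commutant x) = Module.finrank ℂ (LinearMap.ker
      (LinearMap.mulLeft ℂ (Matrix.toLin' x) - LinearMap.mulRight ℂ (Matrix.toLin' x))) := by
  have h : commutant x = (LinearMap.ker (LinearMap.mulLeft ℂ (Matrix.toLin' x) -
      LinearMap.mulRight ℂ (Matrix.toLin' x))).comap
        (Matrix.toLin' : Matrix (Fin n) (Fin n) ℂ ≃ₗ[ℂ] _).toLinearMap := by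
    ext Y
    simp only [commutant, Submodule.mem_comap, LinearMap.mem_ker, LinearMap.sub_apply, sub_eq_zero,
      LinearMap.mulLeft_apply, LinearMap.mulRight_apply, LinearEquiv.coe_coe,
      Module.End.mul_eq_comp, ← Matrix.toLin'_mul, EmbeddingLike.apply_eq_iff_eq]
  rw [h]
  exact (Matrix.toLin'.ofSubmodule' _).finrank_eq

open Classical in
/-- write `n = d·a + b` with `0 ≤ b < d`, and let `x ∈ GL_n(ℂ)` satisfy
`x^d = 1`.  Then `dim_ℂ {Y : xY = Yx} ≥ (d − b)·a² + b·(a+1)²`, with equality iff exactly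
`b` of the `d`-th roots of unity are eigenvalues of `x` of multiplicity `a + 1` and the
remaining `d − b` have multiplicity `a`. -/
theorem commutant_dim_ge_of_pow_eq_one_general {n d a b : ℕ} (hd : 0 < d)
    (hb : b < d) (hn : n = d * a + b) (x : Matrix (Fin n) (Fin n) ℂ)
    (hxu : IsUnit x) (hx : x ^ d = 1) :
    (d - b) * a ^ 2 + b * (a + 1) ^ 2 ≤ Module.finrank ℂ (commutant x) ∧
    (Module.finrank ℂ (commutant x) = (d - b) * a ^ 2 + b * (a + 1) ^ 2 ↔
      ∃ S : Finset ℂ, S.card = b ∧ (∀ z ∈ S, z ^ d = 1) ∧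
        ∀ z : ℂ, z ^ d = 1 → eigMult x z = if z ∈ S then a + 1 else a) := by
  have hs := Module.End.isInternal_eigenspace_nthRoots_of_pow_eq_one (f := Matrix.toLin' x) hd
    (by rw [← Matrix.toLin'_pow, hx, Matrix.toLin'_one]; rfl)
  have hcard : (nthRootsFinset d (1 : ℂ)).card = d :=
    (Complex.isPrimitiveRoot_exp d hd.ne').card_nthRootsFinset
  have hsum : ∑ z ∈ nthRootsFinset d (1 : ℂ), eigMult x z =
      (nthRootsFinset d (1 : ℂ)).card * a + b := by
    rw [hcard, ← hn]
    simpa [eigMult] using (Module.End.finrank_eq_sum_finrank_eigenspace (Matrix.toLin' x) _ hs).symm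
  have hdim : Module.finrank ℂ (commutant x) =
      ∑ z ∈ nthRootsFinset d (1 : ℂ), eigMult x z ^ 2 :=
    (finrank_commutant_eq_finrank_commutant_toLin' x).trans
      (Module.End.finrank_commutant_eq_sum_sq (Matrix.toLin' x) _ hs)
  have hb' : b ≤ (nthRootsFinset d (1 : ℂ)).card := hb.le.trans_eq hcard.symm
  have hle := le_sum_sq_of_sum_eq _ _ hb' hsum
  have hiff := sum_sq_eq_iff_of_sum_eq _ _ hb' hsum
  rw [forall_eq_or_eq_add_one_iff_exists_card_eq _ _ hsum] at hiff
  rw [hcard] at hle hiff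
  rw [hdim]
  refine ⟨hle, hiff.trans ?_⟩
  simp only [Finset.subset_iff, mem_nthRootsFinset hd]
end

section
/- Let n, b, a be positive integers with n = b·a, let J be the standard 2n×2n symplectic matrix (block form [[0, 1_n], [−1_n, 0]]), and let x be a matrix in the complex symplectic group Sp(2n, ℂ) = {g ∈ M_{2n}(ℂ) : gᵀ J g = J} satisfying x^{2b} = −1. Then the ℂ-dimension of {Y ∈ M_{2n}(ℂ) : Yᵀ J + J Y = 0 and xY = Yx} (the centralizer of x in the symplectic Lie algebra) is at least a²·b = n²/b, with equality if and only if the characteristic polynomial of x equals (T^{2b} + 1)^a, i.e. each of the 2b roots of T^{2b} = −1 is an eigenvalue of x with multiplicity exactly a. -/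
open Polynomial
open scoped Matrix

/-- The centralizer of `x` in the Lie algebra `{Y : Yᵀ J + J Y = 0}` attached to the
bilinear form with matrix `J`: the subspace of `Y` with `Yᵀ J + J Y = 0` and `xY = Yx`. -/
noncomputable def lieCentralizer {N : Type*} [Fintype N] [DecidableEq N]
    (J x : Matrix N N ℂ) : Submodule ℂ (Matrix N N ℂ) where
  carrier := {Y | Yᵀ * J + J * Y = 0 ∧ x * Y = Y * x}
  zero_mem' := ⟨by simp, by simp⟩
  add_mem' := by
    intro Y Z hY hZ
    obtain ⟨h1, h2⟩ := hY
    obtain ⟨g1, g2⟩ := hZ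
    constructor
    · calc (Y + Z)ᵀ * J + J * (Y + Z)
          = (Yᵀ * J + J * Y) + (Zᵀ * J + J * Z) := by
            rw [Matrix.transpose_add, Matrix.add_mul, Matrix.mul_add]; abel
        _ = 0 := by rw [h1, g1, add_zero]
    · rw [Matrix.mul_add, Matrix.add_mul, h2, g2]
  smul_mem' := by
    intro c Y hY
    obtain ⟨h1, h2⟩ := hY
    constructor
    · rw [Matrix.transpose_smul, Matrix.smul_mul, Matrix.mul_smul, ← smul_add, h1,
        smul_zero]
    · rw [Matrix.mul_smul, Matrix.smul_mul, h2]

/-- The standard symplectic matrix `J = [[0, 1], [−1, 0]]` of size `2n × 2n`. -/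
noncomputable def stdSymplectic (n : ℕ) : Matrix (Fin n ⊕ Fin n) (Fin n ⊕ Fin n) ℂ :=
  Matrix.fromBlocks 0 1 (-1) 0

/-- A complex matrix with a power equal to `-1` is diagonalizable. -/
theorem Matrix.exists_eq_conj_diagonal_of_pow_eq_neg_one {N : Type*} [Fintype N] [DecidableEq N]
    {x : Matrix N N ℂ} {m : ℕ} (hm : 0 < m) (hx : x ^ m = -1) :
    ∃ (P : (Matrix N N ℂ)ˣ) (d : N → ℂ), x = P.val * Matrix.diagonal d * P⁻¹.val := by
  have hf : Module.End.IsSemisimple (Matrix.toLin' x) := by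
    refine Module.End.isSemisimple_of_squarefree_aeval_eq_zero (p := X ^ m - C (-1 : ℂ))
      (separable_X_pow_sub_C (-1 : ℂ) (by exact_mod_cast hm.ne') (by simp)).squarefree ?_
    rw [map_sub, map_pow, aeval_X, aeval_C, ← Matrix.toLin'_pow, hx]
    ext
    simp
  let S : Set (N → ℂ) := {v | ∃ μ : ℂ, x *ᵥ v = μ • v}
  have hS : ⊤ ≤ Submodule.span ℂ S := by
    rw [← hf.iSup_eigenspace_eq_top, iSup_le_iff]
    intro μ v hv
    exact Submodule.subset_span ⟨μ, by simpa using Module.End.mem_eigenspace_iff.mp hv⟩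
  let b₀ := Module.Basis.ofSpan hS
  let b := b₀.reindex (b₀.indexEquiv (Pi.basisFun ℂ N))
  have hb : ∀ i, ∃ μ : ℂ, x *ᵥ b i = μ • b i := by
    intro i
    have h := Module.Basis.ofSpan_subset hS
      (Set.mem_range_self ((b₀.indexEquiv (Pi.basisFun ℂ N)).symm i))
    rw [Module.Basis.reindex_apply]
    exact h
  choose d hd using hb
  let P : (Matrix N N ℂ)ˣ :=
    ⟨(Pi.basisFun ℂ N).toMatrix b, b.toMatrix (Pi.basisFun ℂ N),
      Module.Basis.toMatrix_mul_toMatrix_flip _ _, Module.Basis.toMatrix_mul_toMatrix_flip _ _⟩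
  refine ⟨P, d, ?_⟩
  rw [Units.eq_mul_inv_iff_mul_eq]
  ext i j
  rw [Matrix.mul_diagonal]
  have h := congrFun (hd j) i
  simpa [P, Module.Basis.toMatrix_apply, Matrix.mul_apply, Matrix.mulVec, dotProduct,
    mul_comm] using h

/-- Symmetric matrices supported on the adjacent pairs of a graph. -/
def SimpleGraph.symmetricMatrices {N : Type*} (G : SimpleGraph N) :
    Submodule ℂ (Matrix N N ℂ) where
  carrier := {B | B.IsSymm ∧ ∀ i j, ¬ G.Adj i j → B i j = 0}
  zero_mem' := ⟨Matrix.isSymm_zero, fun _ _ _ => rfl⟩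
  add_mem' := fun hA hB => ⟨hA.1.add hB.1, fun i j h => by simp [hA.2 i j h, hB.2 i j h]⟩
  smul_mem' := fun c _ hA => ⟨hA.1.smul c, fun i j h => by simp [hA.2 i j h]⟩

theorem SimpleGraph.finrank_symmetricMatrices {N : Type*} [Fintype N] [DecidableEq N]
    (G : SimpleGraph N) [DecidableRel G.Adj] :
    Module.finrank ℂ G.symmetricMatrices = G.edgeFinset.card := by
  let φ : (G.edgeSet → ℂ) →ₗ[ℂ] G.symmetricMatrices :=
    { toFun := fun f => ⟨Matrix.of fun i j => if h : G.Adj i j then f ⟨s(i, j), h⟩ else 0, by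
        refine ⟨?_, fun i j h => by simp [h]⟩
        ext i j
        simp only [Matrix.transpose_apply, Matrix.of_apply, G.adj_comm j i, Sym2.eq_swap (a := j)]⟩
      map_add' := fun f g => by
        ext i j
        by_cases h : G.Adj i j <;> simp [h]
      map_smul' := fun c f => by
        ext i j
        by_cases h : G.Adj i j <;> simp [h] }
  have hφ : Function.Bijective φ := by
    constructor
    · intro f g hfg
      ext ⟨e, he⟩
      induction e using Sym2.ind with
      | _ i j =>
        have h := congrFun (congrFun (congrArg Subtype.val hfg) i) j
        have hij : G.Adj i j := he
        simpa [φ, hij] using h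
    · rintro ⟨B, hB⟩
      refine ⟨fun e => Sym2.lift ⟨fun i j => B i j, fun i j => (hB.1.apply i j).symm⟩ e.1, ?_⟩
      ext i j
      by_cases h : G.Adj i j
      · simp [φ, h]
      · simp [φ, h, hB.2 i j h]
  rw [← (LinearEquiv.ofBijective φ hφ).finrank_eq, Module.finrank_fintype_fun_eq_card,
    SimpleGraph.edgeFinset_card]

/-- The graph on the indices of `d` joining `i` and `j` when `d i` and `d j` are inverse. -/
def inversePairGraph {N : Type*} (d : N → ℂ) (hd : ∀ i, d i * d i ≠ 1) : SimpleGraph N where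
  Adj i j := d i * d j = 1
  symm := ⟨fun i j h => by rwa [mul_comm]⟩
  loopless := ⟨fun i h => hd i h⟩

theorem finrank_lieCentralizer_conj_diagonal {N : Type*} [Fintype N] [DecidableEq N]
    {J : Matrix N N ℂ} (hJ : IsUnit J) (hJt : Jᵀ = -J) (P : (Matrix N N ℂ)ˣ) (d : N → ℂ)
    (hd : ∀ i, d i * d i ≠ 1) {x : Matrix N N ℂ} (hxu : IsUnit x)
    (hxd : x = P.val * Matrix.diagonal d * P⁻¹.val) (hsp : xᵀ * J * x = J) :
    Module.finrank ℂ (lieCentralizer J x) =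
      Module.finrank ℂ (inversePairGraph d hd).symmetricMatrices := by
  have hPt : IsUnit P.valᵀ := (Matrix.isUnit_transpose _).mpr P.isUnit
  have hP : IsUnit P.val := P.isUnit
  have hxt : IsUnit xᵀ := (Matrix.isUnit_transpose _).mpr hxu
  have hxP : x * P.val = P.val * Matrix.diagonal d := by
    rw [hxd, Units.inv_mul_cancel_right]
  have hPx : P.valᵀ * xᵀ = Matrix.diagonal d * P.valᵀ := by
    have := congrArg Matrix.transpose hxP
    simpa using this
  let φ : Matrix N N ℂ →ₗ[ℂ] Matrix N N ℂ :=
    (LinearMap.mulLeft ℂ (P.valᵀ * J)).comp (LinearMap.mulRight ℂ P.val)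
  have hφa : ∀ Y, φ Y = P.valᵀ * J * (Y * P.val) := fun Y => rfl
  have hφ : Function.Injective φ := by
    intro Y Z h
    rw [hφa, hφa] at h
    exact hP.mul_right_cancel ((hPt.mul hJ).mul_left_cancel h)
  let e := LinearEquiv.ofInjectiveEndo φ hφ
  have key : ∀ Y, Y ∈ lieCentralizer J x ↔ φ Y ∈ (inversePairGraph d hd).symmetricMatrices := by
    intro Y
    refine and_congr ?_ ?_
    · rw [Matrix.IsSymm, hφa]
      have h1 : (P.valᵀ * J * (Y * P.val))ᵀ = P.valᵀ * (-(Yᵀ * J)) * P.val := by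
        simp [Matrix.transpose_mul, hJt, Matrix.mul_assoc]
      have h2 : P.valᵀ * J * (Y * P.val) = P.valᵀ * (J * Y) * P.val := by
        simp [Matrix.mul_assoc]
      rw [h1, h2, hP.mul_left_inj, hPt.mul_right_inj, neg_eq_iff_add_eq_zero]
    · have h1 : Matrix.diagonal d * φ Y * Matrix.diagonal d
          = P.valᵀ * (xᵀ * J * (Y * x)) * P.val := by
        calc _ = (Matrix.diagonal d * P.valᵀ) * J * Y * (P.val * Matrix.diagonal d) := by
              simp [hφa, Matrix.mul_assoc]
          _ = _ := by rw [← hPx, ← hxP]; simp [Matrix.mul_assoc]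
      have h2 : φ Y = P.valᵀ * (xᵀ * J * (x * Y)) * P.val := by
        rw [← Matrix.mul_assoc (xᵀ * J), hsp]
        simp [hφa, Matrix.mul_assoc]
      have h3 : x * Y = Y * x ↔ Matrix.diagonal d * φ Y * Matrix.diagonal d = φ Y := by
        rw [h1, h2, hP.mul_left_inj, hPt.mul_right_inj, (hxt.mul hJ).mul_right_inj, eq_comm]
      rw [h3, ← Matrix.ext_iff]
      refine forall_congr' fun i => forall_congr' fun j => ?_
      rw [Matrix.mul_diagonal, Matrix.diagonal_mul]
      have h4 : d i * φ Y i j * d j = φ Y i j ↔ (d i * d j - 1) * φ Y i j = 0 := by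
        rw [← sub_eq_zero]
        ring_nf
      rw [h4, mul_eq_zero, sub_eq_zero, or_iff_not_imp_left]
      rfl
  refine (e.ofSubmodules _ _ ?_).finrank_eq
  ext B
  rw [Submodule.mem_map]
  constructor
  · rintro ⟨Y, hY, rfl⟩
    exact (key Y).mp hY
  · intro hB
    obtain ⟨Y, rfl⟩ := e.surjective B
    exact ⟨Y, (key Y).mpr hB, rfl⟩

theorem roots_charpoly_conj_diagonal {N : Type*} [Fintype N] [DecidableEq N]
    (P : (Matrix N N ℂ)ˣ) (d : N → ℂ) :
    (P.val * Matrix.diagonal d * P⁻¹.val).charpoly.roots = Finset.univ.val.map d := by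
  rw [Matrix.coe_units_inv, Matrix.charpoly_units_conj, Matrix.charpoly_diagonal]
  have h := roots_multiset_prod_X_sub_C (Finset.univ.val.map d)
  rwa [Multiset.map_map] at h

/-- The eigenvalues of an isometry of a nondegenerate bilinear form are stable under inversion,
with multiplicity. -/
theorem map_inv_eigenvalues_eq {N : Type*} [Fintype N] [DecidableEq N]
    {J : Matrix N N ℂ} (hJ : IsUnit J) (P : (Matrix N N ℂ)ˣ) (d : N → ℂ) (hd : ∀ i, d i ≠ 0)
    {x : Matrix N N ℂ} (hxd : x = P.val * Matrix.diagonal d * P⁻¹.val)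
    (hsp : xᵀ * J * x = J) :
    Finset.univ.val.map (fun i => (d i)⁻¹) = Finset.univ.val.map d := by
  obtain ⟨U, rfl⟩ := hJ
  have hmul : x * (P.val * Matrix.diagonal (fun i => (d i)⁻¹) * P⁻¹.val) = 1 := by
    have h : Matrix.diagonal d * Matrix.diagonal (fun i => (d i)⁻¹) = 1 := by
      simp [Matrix.diagonal_mul_diagonal, hd]
    calc _ = P.val * (Matrix.diagonal d * ((P⁻¹.val * P.val) *
            Matrix.diagonal (fun i => (d i)⁻¹))) * P⁻¹.val := by
          rw [hxd]; simp only [Matrix.mul_assoc]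
      _ = 1 := by simp [h]
  have hx : U.val * (P.val * Matrix.diagonal (fun i => (d i)⁻¹) * P⁻¹.val) * U⁻¹.val = xᵀ := by
    rw [Units.mul_inv_eq_iff_eq_mul]
    nth_rw 1 [← hsp]
    rw [Matrix.mul_assoc, hmul, Matrix.mul_one]
  rw [← roots_charpoly_conj_diagonal P, ← roots_charpoly_conj_diagonal P, ← hxd,
    ← Matrix.charpoly_transpose x, ← hx, Matrix.coe_units_inv U,
    Matrix.charpoly_units_conj U]

theorem stdSymplectic_transpose (n : ℕ) : (stdSymplectic n)ᵀ = -stdSymplectic n := by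
  simp [stdSymplectic, Matrix.fromBlocks_transpose, Matrix.fromBlocks_neg]

theorem isUnit_stdSymplectic (n : ℕ) : IsUnit (stdSymplectic n) := by
  refine IsUnit.of_mul_eq_one (-stdSymplectic n) ?_
  simp [stdSymplectic, Matrix.fromBlocks_multiply, Matrix.fromBlocks_neg]

theorem card_roots_X_pow_add_one {m : ℕ} (hm : 0 < m) :
    ((X : ℂ[X]) ^ m + 1).roots.toFinset.card = m := by
  have h : (X : ℂ[X]) ^ m + 1 = X ^ m - C (-1) := by simp
  have hs : ((X : ℂ[X]) ^ m - C (-1)).Separable :=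
    separable_X_pow_sub_C (-1 : ℂ) (by exact_mod_cast hm.ne') (by simp)
  rw [h, Multiset.toFinset_card_of_nodup (nodup_roots hs),
    (splits_iff_card_roots.mp (IsAlgClosed.splits _)), natDegree_X_pow_sub_C]

theorem count_roots_X_pow_add_one_pow {m : ℕ} (hm : 0 < m) (a : ℕ) (z : ℂ) :
    (((X : ℂ[X]) ^ m + 1) ^ a).roots.count z =
      if z ∈ ((X : ℂ[X]) ^ m + 1).roots.toFinset then a else 0 := by
  have h : (X : ℂ[X]) ^ m + 1 = X ^ m - C (-1) := by simp
  have hs : ((X : ℂ[X]) ^ m - C (-1)).Separable :=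
    separable_X_pow_sub_C (-1 : ℂ) (by exact_mod_cast hm.ne') (by simp)
  rw [roots_pow, Multiset.count_nsmul, h, Multiset.count_eq_of_nodup (nodup_roots hs)]
  simp only [Multiset.mem_toFinset]
  split_ifs <;> simp

/-- let `n = b·a` (`a, b ≥ 1`) and let `x ∈ Sp(2n, ℂ)` (i.e. `xᵀ J x = J`)
satisfy `x^{2b} = −1`.  Then the centralizer of `x` in `𝔰𝔭_{2n}(ℂ)` has dimension at least
`a²·b`, with equality iff the characteristic polynomial of `x` is `(T^{2b} + 1)^a`. -/
theorem sp_centralizer_dim_ge_of_pow_eq_neg_one {n b a : ℕ} (hb : 0 < b) (ha : 0 < a)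
    (hn : n = b * a) (x : Matrix (Fin n ⊕ Fin n) (Fin n ⊕ Fin n) ℂ)
    (hsp : xᵀ * stdSymplectic n * x = stdSymplectic n)
    (hx : x ^ (2 * b) = -1) :
    a ^ 2 * b ≤ Module.finrank ℂ (lieCentralizer (stdSymplectic n) x) ∧
    (Module.finrank ℂ (lieCentralizer (stdSymplectic n) x) = a ^ 2 * b ↔
      x.charpoly = ((X : ℂ[X]) ^ (2 * b) + 1) ^ a) := by
  classical
  have hm : 0 < 2 * b := by omega
  have hJ := isUnit_stdSymplectic n
  have hxu : IsUnit x := by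
    refine (isUnit_pow_iff hm.ne').mp ?_
    rw [hx]
    exact isUnit_one.neg
  obtain ⟨P, d, hxd⟩ := Matrix.exists_eq_conj_diagonal_of_pow_eq_neg_one hm hx
  have hdpow : ∀ i, d i ^ (2 * b) = -1 := by
    intro i
    have h : P.val * Matrix.diagonal d ^ (2 * b) * P⁻¹.val = -1 := by
      rw [← Units.conj_pow, ← hxd, hx]
    rw [Units.mul_inv_eq_iff_eq_mul, neg_one_mul, ← mul_neg_one, P.isUnit.mul_right_inj,
      Matrix.diagonal_pow] at h
    simpa using congrFun (congrFun h i) i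
  have hd0 : ∀ i, d i ≠ 0 := by
    intro i h
    simpa [h, hm.ne'] using hdpow i
  have hd1 : ∀ i, d i * d i ≠ 1 := by
    intro i h
    have h2 := hdpow i
    rw [pow_mul, sq, h, one_pow] at h2
    norm_num at h2
  set R := ((X : ℂ[X]) ^ (2 * b) + 1).roots.toFinset with hR
  have hq : (X : ℂ[X]) ^ (2 * b) + 1 ≠ 0 := (monic_X_pow_add_C (1 : ℂ) hm.ne').ne_zero
  have hdR : ∀ i, d i ∈ R := by
    intro i
    simp [hR, mem_roots hq, hdpow i]
  let μ : ℂ → ℕ := fun z => (Finset.univ.filter fun i => d i = z).card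
  have hcount : ∀ z, x.charpoly.roots.count z = μ z := by
    intro z
    rw [hxd, roots_charpoly_conj_diagonal, Multiset.count_map]
    simp only [eq_comm (a := z)]
    rfl
  have hinv : ∀ z, (Finset.univ.filter fun i => (d i)⁻¹ = z).card = μ z := by
    intro z
    have h := congrArg (Multiset.count z) (map_inv_eigenvalues_eq hJ P d hd0 hxd hsp)
    rw [Multiset.count_map, Multiset.count_map] at h
    simp only [eq_comm (a := z)] at h
    exact h
  have hdim : ∑ z ∈ R, μ z ^ 2 =
      2 * Module.finrank ℂ (lieCentralizer (stdSymplectic n) x) := by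
    rw [finrank_lieCentralizer_conj_diagonal hJ (stdSymplectic_transpose n) P d hd1 hxu hxd hsp,
      SimpleGraph.finrank_symmetricMatrices, ← SimpleGraph.sum_degrees_eq_twice_card_edges,
      ← Finset.sum_fiberwise_of_maps_to (fun i _ => hdR i)]
    refine Finset.sum_congr rfl fun z _ => ?_
    rw [sq, ← smul_eq_mul]
    refine (Finset.sum_const (μ z)).symm.trans (Finset.sum_congr rfl fun i hi => ?_)
    rw [← hinv, ← SimpleGraph.card_neighborFinset_eq_degree]
    congr 1
    ext j
    rw [SimpleGraph.mem_neighborFinset, Finset.mem_filter, ← (Finset.mem_filter.mp hi).2]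
    simp only [Finset.mem_univ, true_and]
    rw [inv_eq_iff_eq_inv, ← mul_eq_one_iff_eq_inv₀ (hd0 i), mul_comm]
    rfl
  have hsum : ∑ z ∈ R, μ z = 2 * (b * a) := by
    rw [← Finset.card_eq_sum_card_fiberwise (fun i _ => hdR i)]
    simp [hn, two_mul]
  have hvar : (∑ z ∈ R, ((μ z : ℤ) - a) ^ 2) =
      2 * (Module.finrank ℂ (lieCentralizer (stdSymplectic n) x) : ℤ) - 2 * (a ^ 2 * b) := by
    have h1 : (∑ z ∈ R, (μ z : ℤ) ^ 2) =
        2 * (Module.finrank ℂ (lieCentralizer (stdSymplectic n) x) : ℤ) := by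
      exact_mod_cast hdim
    have h2 : (∑ z ∈ R, (μ z : ℤ)) = 2 * (b * a) := by exact_mod_cast hsum
    simp only [sub_sq, Finset.sum_add_distrib, Finset.sum_sub_distrib, ← Finset.sum_mul,
      ← Finset.mul_sum, Finset.sum_const, hR, card_roots_X_pow_add_one hm]
    rw [← hR, h1, h2]
    simp
    ring
  have hcharpoly : x.charpoly = ((X : ℂ[X]) ^ (2 * b) + 1) ^ a ↔ ∀ z ∈ R, μ z = a := by
    constructor
    · intro h z hz
      rw [← hcount, h, count_roots_X_pow_add_one_pow hm, if_pos hz]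
    · intro h
      have hroots : x.charpoly.roots = (((X : ℂ[X]) ^ (2 * b) + 1) ^ a).roots := by
        ext z
        rw [hcount, count_roots_X_pow_add_one_pow hm]
        split_ifs with hz
        · exact h z hz
        · refine Finset.card_eq_zero.mpr (Finset.filter_eq_empty_iff.mpr ?_)
          rintro i - rfl
          exact hz (hdR i)
      rw [(IsAlgClosed.splits x.charpoly).eq_prod_roots_of_monic x.charpoly_monic, hroots]
      exact ((IsAlgClosed.splits _).eq_prod_roots_of_monic
        ((monic_X_pow_add_C (1 : ℂ) hm.ne').pow a)).symm
  have hnonneg : 0 ≤ ∑ z ∈ R, ((μ z : ℤ) - a) ^ 2 := Finset.sum_nonneg fun _ _ => sq_nonneg _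
  constructor
  · zify
    linarith
  · rw [hcharpoly]
    have h0 : Module.finrank ℂ (lieCentralizer (stdSymplectic n) x) = a ^ 2 * b ↔
        ∑ z ∈ R, ((μ z : ℤ) - a) ^ 2 = 0 := by
      rw [hvar]
      zify
      constructor <;> intro h <;> linarith
    rw [h0, Finset.sum_eq_zero_iff_of_nonneg fun _ _ => sq_nonneg _]
    refine forall₂_congr fun z _ => ?_
    rw [sq_eq_zero_iff, sub_eq_zero, Nat.cast_inj]
end
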